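/- arXiv:2504.05582 — 2 statements merged into one kernel-verified Lean document; each statement's English description precedes it below -/
import Mathlib

section
/- Let τ = (τ_n : A_{n+1}* → A_n*)_{n≥0} be a constant-length, primitive, proper and recognizable directive sequence with |A_{n+1}| = 2 for every n ≥ 0, and suppose the S-adic subshift X_τ ⊆ A_0^ℤ is aperiodic. Then there is exactly one centered left asymptotic pair {x, x̃} in X_τ: such a pair exists, and any two centered left asymptotic pairs in X_τ coincide as unordered pairs. Moreover, every integer i < 0 lies in Per(x) ∩ Per(x̃). -/
namespace ToeplitzFR

open Set

variable {A B C : Type*}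

/-- The shift map `S` on `ℤ → A`: `S(x)(i) = x(i+1)`. -/
def shift (x : ℤ → A) : ℤ → A := fun i => x (i + 1)

/-- The inverse shift map `S⁻¹`. -/
def shiftInv (x : ℤ → A) : ℤ → A := fun i => x (i - 1)

/-- The shift by `k`: `S^k`. -/
def shiftBy (k : ℤ) (x : ℤ → A) : ℤ → A := fun i => x (i + k)

/-- The finite word `x[i, i+n)`. -/
def factorAt (x : ℤ → A) (i : ℤ) (n : ℕ) : List A :=
  (List.range n).map fun j => x (i + j)

/-- `x` is a periodic point of the shift. -/
def IsPeriodicPoint (x : ℤ → A) : Prop := ∃ p : ℕ, 0 < p ∧ ∀ i : ℤ, x (i + p) = x i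

def IsAperiodicPoint (x : ℤ → A) : Prop := ¬ IsPeriodicPoint x

/-- `Per_p(x)`. -/
def PerSet (x : ℤ → A) (p : ℕ) : Set ℤ := {i : ℤ | ∀ k : ℤ, x (i + k * p) = x i}

/-- `Per(x) = ⋃_{p>1} Per_p(x)`. -/
def PerAll (x : ℤ → A) : Set ℤ := {i : ℤ | ∃ p : ℕ, 1 < p ∧ i ∈ PerSet x p}

/-- `x` is a Toeplitz sequence. -/
def IsToeplitz (x : ℤ → A) : Prop := ∀ i : ℤ, ∃ p : ℕ, 1 < p ∧ i ∈ PerSet x p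

/-- The shift orbit of `x`. -/
def orbit (x : ℤ → A) : Set (ℤ → A) := {y | ∃ k : ℤ, y = shiftBy k x}

/-- `X` is the Toeplitz subshift generated by the Toeplitz sequence `x`. -/
def ToeplitzGenerates [TopologicalSpace A] (x : ℤ → A) (X : Set (ℤ → A)) : Prop :=
  IsToeplitz x ∧ X = closure (orbit x)

/-- `X` is a Toeplitz subshift. -/
def IsToeplitzSubshift [TopologicalSpace A] (X : Set (ℤ → A)) : Prop :=
  ∃ x : ℤ → A, ToeplitzGenerates x X

/-- The `p`-skeleton of `x`, with `none` as the blank symbol. -/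
noncomputable def Skel (x : ℤ → A) (p : ℕ) : ℤ → Option A :=
  fun i => @ite _ (i ∈ PerSet x p) (Classical.dec _) (some (x i)) none

/-- `p` is an essential period of `x`. -/
def IsEssentialPeriod (x : ℤ → A) (p : ℕ) : Prop :=
  1 < p ∧ ∀ q : ℕ, 0 < q → q < p → ∃ i : ℤ, Skel x p (i + q) ≠ Skel x p i

/-- `(P n)` is a period structure for `x`. -/
def IsPeriodStructure (x : ℤ → A) (P : ℕ → ℕ) : Prop :=
  StrictMono P ∧ (∀ n, IsEssentialPeriod x (P n)) ∧ (∀ n, P n ∣ P (n+1)) ∧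
    ∀ i : ℤ, ∃ n, i ∈ PerSet x (P n)

/-- `q` divides the scale of the Toeplitz subshift `X`. -/
def DividesScale [TopologicalSpace A] (X : Set (ℤ → A)) (q : ℕ) : Prop :=
  ∃ (x : ℤ → A) (P : ℕ → ℕ),
    ToeplitzGenerates x X ∧ IsPeriodStructure x P ∧ ∃ n, q ∣ P n

/-! ### Directive sequences and S-adic subshifts -/

/-- All morphisms in the directive sequence are non-erasing. -/
def NonErasing {A : ℕ → Type*} (τ : ∀ n, A (n+1) → List (A n)) : Prop :=
  ∀ n a, τ n a ≠ []

/-- The directive sequence has constant length. -/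
def ConstantLength {A : ℕ → Type*} (τ : ∀ n, A (n+1) → List (A n)) : Prop :=
  ∀ n, ∀ a b : A (n+1), (τ n a).length = (τ n b).length

/-- The directive sequence is proper. -/
def ProperSeq {A : ℕ → Type*} (τ : ∀ n, A (n+1) → List (A n)) : Prop :=
  ∀ n, ∃ b c : A n, ∀ a : A (n+1), (τ n a).head? = some b ∧ (τ n a).getLast? = some c

/-- `sadicWordAux τ n k a = τ_{[n, n+k)}(a)`. -/
def sadicWordAux {A : ℕ → Type*} (τ : ∀ n, A (n+1) → List (A n)) (n : ℕ) :
    ∀ k : ℕ, A (n + k) → List (A n)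
  | 0, a => [a]
  | (k+1), a => (τ (n+k) a).flatMap (sadicWordAux τ n k)

/-- `word0 τ k a = τ_{[0, k)}(a)` for `a ∈ A k`. -/
def word0 {A : ℕ → Type*} (τ : ∀ n, A (n+1) → List (A n)) :
    ∀ k : ℕ, A k → List (A 0)
  | 0, a => [a]
  | (k+1), a => (τ k a).flatMap (word0 τ k)

/-- The directive sequence is primitive. -/
def PrimitiveSeq {A : ℕ → Type*} (τ : ∀ n, A (n+1) → List (A n)) : Prop :=
  ∀ n, ∃ k : ℕ, 0 < k ∧ ∀ (a : A (n+k)) (b : A n), b ∈ sadicWordAux τ n k a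

/-- The `n`-th level `X_τ^{(n)}` of the S-adic system generated by `τ`. -/
def XLevel {A : ℕ → Type*} (τ : ∀ n, A (n+1) → List (A n)) (n : ℕ) :
    Set (ℤ → A n) :=
  {y | ∀ (i : ℤ) (m : ℕ), ∃ k : ℕ, 0 < k ∧ ∃ a : A (n+k),
      (factorAt y i m).IsInfix (sadicWordAux τ n k a)}

/-- The alphabet rank (`liminf_n |A_n|`) is at most `K`. -/
def AlphabetRankLE (A : ℕ → Type*) [∀ n, Fintype (A n)] (K : ℕ) : Prop :=
  ∀ N : ℕ, ∃ n, N ≤ n ∧ Fintype.card (A n) ≤ K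

/-! ### Recognizability -/

/-- `z` is the bi-infinite concatenation `⋯σ(y(-1)).σ(y(0))σ(y(1))⋯`,
with `σ(y(0))` starting at coordinate `0`. -/
def IsConcat (σ : B → List C) (y : ℤ → B) (z : ℤ → C) : Prop :=
  ∃ c : ℤ → ℤ, c 0 = 0 ∧ (∀ j : ℤ, c (j + 1) = c j + (σ (y j)).length) ∧
    ∀ (j : ℤ) (m : Fin (σ (y j)).length), z (c j + (m : ℕ)) = (σ (y j)).get m

/-- `(y, k)` is a centered `σ`-representation of `x` in `Y`. -/
def IsCenteredRep (σ : B → List C) (Y : Set (ℤ → B)) (x : ℤ → C)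
    (y : ℤ → B) (k : ℕ) : Prop :=
  y ∈ Y ∧ k < (σ (y 0)).length ∧ IsConcat σ y (fun m => x (m - k))

/-- The morphism `σ` is recognizable in `Y`. -/
def RecognizableIn (σ : B → List C) (Y : Set (ℤ → B)) : Prop :=
  ∀ (x : ℤ → C) (y y' : ℤ → B) (k k' : ℕ),
    IsCenteredRep σ Y x y k → IsCenteredRep σ Y x y' k' → y = y' ∧ k = k'

/-- The directive sequence `τ` is recognizable. -/
def RecognizableSeq {A : ℕ → Type*} (τ : ∀ n, A (n+1) → List (A n)) : Prop :=
  ∀ n, RecognizableIn (τ n) (XLevel τ (n+1))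

/-! ### Conjugacy -/

/-- `(X, TX)` and `(Y, TY)` are conjugate via a homeomorphism. -/
def ConjugateBy [TopologicalSpace A] [TopologicalSpace B]
    (X : Set (ℤ → A)) (Y : Set (ℤ → B))
    (TX : (ℤ → A) → (ℤ → A)) (TY : (ℤ → B) → (ℤ → B)) : Prop :=
  ∃ φ : ↥X ≃ₜ ↥Y, ∀ (x : ℤ → A) (hx : x ∈ X) (hx' : TX x ∈ X),
    (φ ⟨TX x, hx'⟩).1 = TY (φ ⟨x, hx⟩).1

/-- `(X, S)` and `(Y, S)` are conjugate subshifts. -/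
def Conjugate [TopologicalSpace A] [TopologicalSpace B]
    (X : Set (ℤ → A)) (Y : Set (ℤ → B)) : Prop :=
  ConjugateBy X Y shift shift

/-- `X` is a strong Toeplitz subshift of rank `K`: it is conjugate to the S-adic subshift
of a constant-length, primitive, proper and recognizable directive sequence of
alphabet rank at most `K`. -/
def IsStrongToeplitzOfRank [TopologicalSpace A] (X : Set (ℤ → A)) (K : ℕ) : Prop :=
  ∃ (B : ℕ → Type) (iB : ∀ n, Fintype (B n)) (σ : ∀ n, B (n+1) → List (B n)),
    NonErasing σ ∧ ConstantLength σ ∧ PrimitiveSeq σ ∧ ProperSeq σ ∧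
    RecognizableSeq σ ∧ @AlphabetRankLE B iB K ∧
    @Conjugate A (B 0) _ ⊥ X (XLevel σ 0)

/-- `X` is conjugate to the S-adic subshift of a primitive, proper and recognizable
directive sequence of alphabet rank at most `K`. -/
def HasFiniteRankSAdicRep [TopologicalSpace A] (X : Set (ℤ → A)) (K : ℕ) : Prop :=
  ∃ (B : ℕ → Type) (iB : ∀ n, Fintype (B n)) (σ : ∀ n, B (n+1) → List (B n)),
    NonErasing σ ∧ PrimitiveSeq σ ∧ ProperSeq σ ∧
    RecognizableSeq σ ∧ @AlphabetRankLE B iB K ∧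
    @Conjugate A (B 0) _ ⊥ X (XLevel σ 0)

/-! ### Cuts, languages, built-from -/

/-- The set of words `{x[t+kp, t+(k+1)p) : k ∈ ℤ}`. -/
def cutWords (x : ℤ → A) (p t : ℕ) : Set (List A) :=
  {w | ∃ k : ℤ, w = factorAt x ((t : ℤ) + k * p) p}

/-- `(p, t)` is a strong rank-2 cut of `x`. -/
def StrongRank2Cut (x : ℤ → A) (p t : ℕ) : Prop :=
  t < p ∧ ∃ u v : List A, u ≠ v ∧ cutWords x p t = {u, v}

/-- The language `L_n(X)`. -/
def Lang (n : ℕ) (X : Set (ℤ → A)) : Set (List A) :=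
  {w | ∃ x ∈ X, ∃ i : ℤ, w = factorAt x i n}

/-- The maximal common prefix of `u` and `v` has length greater than `m`. -/
def CommonPrefixLongerThan (u v : List A) (m : ℕ) : Prop :=
  m + 1 ≤ u.length ∧ m + 1 ≤ v.length ∧ u.take (m+1) = v.take (m+1)

/-- The maximal common suffix of `u` and `v` has length greater than `m`. -/
def CommonSuffixLongerThan (u v : List A) (m : ℕ) : Prop :=
  CommonPrefixLongerThan u.reverse v.reverse m

/-- `b = (β₀, (α₁, …, α_k), β₁)` is a building of the word `w` from `W`:
`w = β₀α₁⋯α_kβ₁`, all `αᵢ ∈ W`, `β₀` is a proper suffix of an element of `W`,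
and `β₁` is a proper prefix of an element of `W`. -/
def IsBuilding (W : Set (List A)) (w : List A)
    (b : List A × List (List A) × List A) : Prop :=
  w = b.1 ++ b.2.1.flatten ++ b.2.2 ∧ (∀ α ∈ b.2.1, α ∈ W) ∧
  (∃ u ∈ W, b.1 <:+ u ∧ b.1 ≠ u) ∧ (∃ u ∈ W, b.2.2 <+: u ∧ b.2.2 ≠ u)

/-- `w` is uniquely built from `W`. -/
def UniquelyBuiltFrom (W : Set (List A)) (w : List A) : Prop :=
  ∃! b : List A × List (List A) × List A, IsBuilding W w b

/-- `X` together with one of its points satisfies the strong rank-2 cut property. -/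
def GoodCuts [TopologicalSpace A] (X : Set (ℤ → A)) (x : ℤ → A) : Prop :=
  ∀ p : ℕ, 0 < p → DividesScale X p → ∀ m : ℕ,
    ∃ q t : ℕ, StrongRank2Cut x q t ∧ p ∣ q ∧ DividesScale X q ∧
      ∃ u v : List A, u ≠ v ∧ cutWords x q t = {u, v} ∧
        CommonPrefixLongerThan u v m ∧ CommonSuffixLongerThan u v m

/-! ### Euclidean pairs and buildings of bi-infinite sequences -/

/-- `{u, v}` is a Euclidean pair. -/
def EuclideanPair (u v : List A) : Prop :=
  ∃ (w : List A) (k l : ℕ),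
    u = (List.replicate k w).flatten ∧ v = (List.replicate l w).flatten

/-- `α` is the distinguished prefix of `u` and `v`. -/
def IsDistinguishedPrefix (u v α : List A) : Prop :=
  α.length < u.length + v.length ∧
  ∀ x y : List A,
    (∃ l : List (List A), (∀ w ∈ l, w = u ∨ w = v) ∧ x = u ++ l.flatten) →
    (∃ l : List (List A), (∀ w ∈ l, w = u ∨ w = v) ∧ y = v ++ l.flatten) →
    α.length + 1 ≤ x.length → α.length + 1 ≤ y.length →
    α <+: x ∧ α <+: y ∧ x[α.length]? ≠ y[α.length]?

/-- `β` is the distinguished suffix of `u` and `v`. -/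
def IsDistinguishedSuffix (u v β : List A) : Prop :=
  IsDistinguishedPrefix u.reverse v.reverse β.reverse

/-- `(c, f)` is a building of the bi-infinite sequence `x` from `W`:
block `j` starts at position `c j` and carries the word `f j ∈ W`. -/
def IsBuildingSeq (W : Set (List A)) (x : ℤ → A) (c : ℤ → ℤ) (f : ℤ → List A) : Prop :=
  (∀ j : ℤ, f j ∈ W) ∧ (∀ j : ℤ, c (j + 1) = c j + (f j).length) ∧
  ∀ (j : ℤ) (m : Fin (f j).length), x (c j + (m : ℕ)) = (f j).get m

/-- The subshift `X_{u,v}` of all sequences built from `{u, v}`. -/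
def Xuv (u v : List A) : Set (ℤ → A) :=
  {x | ∃ (c : ℤ → ℤ) (f : ℤ → List A), IsBuildingSeq {u, v} x c f}

/-! ### Block-code conjugacies -/

/-- A conjugacy `φ : X → Y` admitting block width `2n+1`. -/
structure BlockConjugacy (A : Type*) (X Y : Set (ℤ → A)) (n : ℕ) where
  toFun : (ℤ → A) → (ℤ → A)
  invFun : (ℤ → A) → (ℤ → A)
  maps_to : ∀ x ∈ X, toFun x ∈ Y
  maps_from : ∀ y ∈ Y, invFun y ∈ X
  left_inv : ∀ x ∈ X, invFun (toFun x) = x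
  right_inv : ∀ y ∈ Y, toFun (invFun y) = y
  shift_comm : ∀ x ∈ X, toFun (shift x) = shift (toFun x)
  code : List A → A
  code_inv : List A → A
  code_spec : ∀ x ∈ X, ∀ i : ℤ, toFun x i = code (factorAt x (i - n) (2*n+1))
  code_inv_spec : ∀ y ∈ Y, ∀ i : ℤ, invFun y i = code_inv (factorAt y (i - n) (2*n+1))

/-! ### Parts, permutation action, χ -/

/-- `W` is a member of `Parts(X, p)`: a class of the common-`p`-skeleton relation. -/
def SkelClass (X : Set (ℤ → A)) (p : ℕ) (W : Set (ℤ → A)) : Prop :=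
  ∃ y ∈ X, W = {z ∈ X | Skel z p = Skel y p}

/-- The map `ψ̂` induced by a permutation `ψ` of `A^p`. -/
def permHat (p : ℕ) (ψ : Equiv.Perm (Fin p → A)) (x : ℤ → A) : ℤ → A :=
  fun i =>
    if h : (i.emod p).toNat < p then
      ψ (fun m : Fin p => x (i - i.emod p + (m : ℕ))) ⟨(i.emod p).toNat, h⟩
    else x i

/-- The relation `E_p` on compact subsets of `A^ℤ`. -/
def EpRel (p : ℕ) (K L : Set (ℤ → A)) : Prop :=
  ∃ ψ : Equiv.Perm (Fin p → A), L = permHat p ψ '' K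

/-- `W ∈ Parts_*(X, p)`. -/
def SkelClassStar (X : Set (ℤ → A)) (p : ℕ) (W : Set (ℤ → A)) : Prop :=
  SkelClass X p W ∧ ∀ y ∈ W, Skel y p (-1) = none ∧ Skel y p 0 ≠ none

/-- `length(W) = L` for `W ∈ Parts_*(X, p)`. -/
def HasLength (p : ℕ) (W : Set (ℤ → A)) (L : ℕ) : Prop :=
  ∀ y ∈ W, (∀ i : ℕ, i < L → Skel y p (i : ℤ) ≠ none) ∧ Skel y p (L : ℤ) = none

/-- `Z ∈ χ(X, p)`. -/
def ChiMem (X : Set (ℤ → A)) (p : ℕ) (Z : Set (ℤ → A)) : Prop :=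
  ∃ (W : Set (ℤ → A)) (L : ℕ), SkelClassStar X p W ∧ HasLength p W L ∧
    (∀ (W' : Set (ℤ → A)) (L' : ℕ),
      SkelClassStar X p W' → HasLength p W' L' → L' ≤ L) ∧
    Z = shiftBy ((L / 2 : ℕ) : ℤ) '' W

/-- `χ(X, p) E_p^fin χ(Y, p)`. -/
def ChiEpFin (X Y : Set (ℤ → A)) (p : ℕ) : Prop :=
  (∀ K, ChiMem X p K → ∃ L, ChiMem Y p L ∧ EpRel p K L) ∧
  (∀ L, ChiMem Y p L → ∃ K, ChiMem X p K ∧ EpRel p K L)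

/-! ### Single holes and fillings -/

/-- The Toeplitz sequence `x` has single holes with respect to the period structure `P`. -/
def SingleHoles (x : ℤ → A) (P : ℕ → ℕ) : Prop :=
  IsPeriodStructure x P ∧
  ∀ n, ∃! i : ℤ, 0 ≤ i ∧ i < (P n : ℤ) ∧ i ∉ PerSet x (P n)

/-- The Toeplitz subshift `X` has single holes. -/
def HasSingleHoles [TopologicalSpace A] (X : Set (ℤ → A)) : Prop :=
  ∃ (x : ℤ → A) (P : ℕ → ℕ), ToeplitzGenerates x X ∧ SingleHoles x P

/-- `w` is the `(n, m)`-filling of `x` (for periods `pn < pm`). -/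
def IsFilling (x : ℤ → A) (pn pm : ℕ) (w : List A) : Prop :=
  w.length = pm / pn - 1 ∧
  ∀ h : ℤ, 0 ≤ h → h < (pm : ℤ) → h ∉ PerSet x pm →
    ∀ (j : ℕ) (hj : j < w.length), w.get ⟨j, hj⟩ = x (h + (j+1) * pn)

/-- `u` is a `θ`-palindrome. -/
def ThetaPalindrome (θ : Equiv.Perm A) (u : List A) : Prop :=
  u.map (fun a => θ a) = u.reverse

/-! ### Nice symmetries -/

/-- `x` has nice symmetries with respect to `(p, q)`. -/
def NiceSymmetries (x : ℤ → A) (p q : ℕ) : Prop :=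
  ∃ m : ℤ, 1 < m ∧ m ≤ (q : ℤ) + 1 ∧
    (∀ k : ℕ, k < q / p →
      (Set.Ico ((k * p : ℕ) : ℤ) (((k+1) * p : ℕ) : ℤ) ⊆ PerSet x q ↔
       Set.Ico (m - ((k+1) * p : ℕ)) (m - (k * p : ℕ)) ⊆ PerSet x q)) ∧
    (∀ k k' : ℕ, k < q / p → k' < q / p →
      Set.Ico ((k * p : ℕ) : ℤ) (((k+1) * p : ℕ) : ℤ) ⊆ PerSet x q →
      Set.Ico ((k' * p : ℕ) : ℤ) (((k'+1) * p : ℕ) : ℤ) ⊆ PerSet x q →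
      (factorAt x ((k * p : ℕ) : ℤ) p = factorAt x ((k' * p : ℕ) : ℤ) p ↔
       factorAt x (m - ((k+1) * p : ℕ)) p = factorAt x (m - ((k'+1) * p : ℕ)) p))

/-- For some `p` dividing the scale of `X`, `x` has nice symmetries with respect to
`(p, q)` for all `q > p` with `p ∣ q` dividing the scale of `X`. -/
def NiceSymAll [TopologicalSpace A] (X : Set (ℤ → A)) (x : ℤ → A) : Prop :=
  ∃ p : ℕ, 0 < p ∧ DividesScale X p ∧
    ∀ q : ℕ, p < q → p ∣ q → DividesScale X q → NiceSymmetries x p q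

/-- A pair `(x, x')` is a centered left asymptotic pair. -/
def CenteredLeftAsymptoticPair (x x' : ℤ → A) : Prop :=
  (∀ i : ℤ, i < 0 → x i = x' i) ∧ x 0 ≠ x' 0

/-! ### Automorphism groups -/

/-- `e` is an automorphism of the subshift `(X, S)`. -/
def IsShiftAutomorphism [TopologicalSpace A] (X : Set (ℤ → A)) (e : ↥X ≃ₜ ↥X) : Prop :=
  ∀ (x : ℤ → A) (hx : x ∈ X) (hx' : shift x ∈ X),
    (e ⟨shift x, hx'⟩).1 = shift (e ⟨x, hx⟩).1

/-- The automorphism group of `(X, S)` is isomorphic, as a group, to `ℤ × ℤ/nℤ`. -/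
def AutGroupIsoZxZmod [TopologicalSpace A] (X : Set (ℤ → A)) (n : ℕ) : Prop :=
  ∃ Φ : {e : ↥X ≃ₜ ↥X // IsShiftAutomorphism X e} → ℤ × ZMod n,
    Function.Bijective Φ ∧
    ∀ e f g : {e : ↥X ≃ₜ ↥X // IsShiftAutomorphism X e},
      (∀ z : ↥X, g.1 z = e.1 (f.1 z)) → Φ g = Φ e + Φ f

/-! ### The Polish space of subshifts over `ℤ` -/

/-- A point of the space `𝐒` of all (compact, nonempty, shift-invariant) subshifts
over finite alphabets contained in `ℤ`. -/
structure SubshiftSpace : Type where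
  carrier : Set (ℤ → ℤ)
  nonempty : carrier.Nonempty
  compact : IsCompact carrier
  invariant : shift '' carrier = carrier

/-- The topology on `𝐒` induced by the languages `(L_n(X))_{n}`, with each
family of `n`-languages discrete; this coincides with the metric
`d(X,Y) = 2^{-min{n : L_n(X) ≠ L_n(Y)}}`. -/
instance : TopologicalSpace SubshiftSpace :=
  TopologicalSpace.induced
    (fun X : SubshiftSpace => (fun n => Lang n X.carrier : ℕ → Set (List ℤ)))
    (@Pi.topologicalSpace ℕ (fun _ => Set (List ℤ)) (fun _ => ⊥))

/-- The subset `𝐌 ⊆ 𝐒` of infinite minimal subshifts. -/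
def MinimalSet : Set SubshiftSpace :=
  {X | X.carrier.Infinite ∧ ∀ x ∈ X.carrier, X.carrier ⊆ closure (orbit x)}


/-! ### Auxiliary lemmas for the main theorem -/

theorem aux_getElem?_flatMap {B C : Type*} (f : B → List C) (l : ℕ) (hf : ∀ b, (f b).length = l) :
    ∀ (w : List B) (q s : ℕ), s < l →
      (w.flatMap f)[l * q + s]? = (w[q]?).bind (fun b => (f b)[s]?)
  | [], q, s, hs => by simp
  | b :: w, 0, s, hs => by
      have : s < (f b).length := by rw [hf]; exact hs
      simp [List.flatMap_cons, List.getElem?_append_left this]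
  | b :: w, q + 1, s, hs => by
      have h1 : (f b).length ≤ l * (q + 1) + s := by
        rw [hf, Nat.mul_succ]; omega
      have h2 : l * (q + 1) + s - (f b).length = l * q + s := by
        rw [hf, Nat.mul_succ]; omega
      rw [List.flatMap_cons, List.getElem?_append_right h1, h2,
        aux_getElem?_flatMap f l hf w q s hs]
      simp

theorem aux_length_flatMap {B C : Type*} (f : B → List C) (l : ℕ) (hf : ∀ b, (f b).length = l)
    (w : List B) : (w.flatMap f).length = l * w.length := by
  induction w with
  | nil => simp
  | cons b w ih => rw [List.flatMap_cons, List.length_append, ih, hf, List.length_cons,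
      Nat.mul_succ, Nat.add_comm]

theorem aux_factorAt_eq {B : Type*} (x : ℤ → B) (i : ℤ) (m : ℕ) :
    factorAt x i m = (List.range m).map (fun j : ℕ => x (i + (j : ℤ))) := by
  unfold factorAt
  rw [List.map_eq_flatMap (l := List.range m)]
  simp [List.map_flatMap]

theorem aux_factorAt_infix {B : Type*} (x : ℤ → B) (i : ℤ) (m : ℕ) (w : List B) :
    (factorAt x i m).IsInfix w ↔
      ∃ o : ℕ, o + m ≤ w.length ∧ ∀ j : ℕ, j < m → w[o + j]? = some (x (i + j)) := by
  have hlen : (factorAt x i m).length = m := by simp [aux_factorAt_eq]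
  constructor
  · rintro ⟨s, t, rfl⟩
    refine ⟨s.length, by simp [hlen], fun j hj => ?_⟩
    rw [List.append_assoc, List.getElem?_append_right (by omega),
      List.getElem?_append_left (by rw [hlen]; omega)]
    simp [aux_factorAt_eq, hj]
  · rintro ⟨o, ho, h⟩
    have : factorAt x i m = (w.drop o).take m := by
      apply List.ext_getElem?
      intro j
      by_cases hj : j < m
      · rw [List.getElem?_take_of_lt hj, List.getElem?_drop, h j hj]
        simp [aux_factorAt_eq, hj]
      · rw [List.getElem?_eq_none (by omega), List.getElem?_eq_none (by simp; omega)]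
    rw [this]
    exact ((List.take_prefix _ _).isInfix).trans (List.drop_suffix _ _).isInfix

theorem aux_ultra {B : Type*} [Finite B] (f : ℕ → B) :
    ∃ b, ∀ᶠ m in (Filter.hyperfilter ℕ : Filter ℕ), f m = b := by
  obtain ⟨b, hb⟩ := Ultrafilter.eq_pure_of_finite ((Filter.hyperfilter ℕ).map f)
  refine ⟨b, ?_⟩
  have : ({b} : Set B) ∈ (Filter.hyperfilter ℕ).map f := by
    rw [hb]; exact Filter.mem_pure.2 rfl
  exact this

theorem aux_ultra_ge (N : ℕ) : ∀ᶠ m in (Filter.hyperfilter ℕ : Filter ℕ), N ≤ m :=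
  (Filter.eventually_ge_atTop N).filter_mono Nat.hyperfilter_le_atTop

section casts

variable {A : ℕ → Type} (τ : ∀ n, A (n+1) → List (A n))

theorem aux_cast (m m' : ℕ) (h : m = m') (a : A (m+1)) :
    τ m' (cast (by rw [h]) a) = (τ m a).map (cast (by rw [h])) := by
  subst h
  exact (List.map_id (τ m a)).symm

theorem aux_sadic_succ (n : ℕ) : ∀ (k : ℕ) (a : A (n + (k+1))),
    sadicWordAux τ n (k+1) a =
      (sadicWordAux τ (n+1) k (cast (by congr 1; omega) a)).flatMap (τ n)
  | 0, a => by
      rw [sadicWordAux]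
      change (τ n a).flatMap (fun b => [b]) = [a].flatMap (τ n)
      simp
  | k+1, a => by
      rw [sadicWordAux, funext (aux_sadic_succ n k)]
      conv_rhs => rw [sadicWordAux]
      have := aux_cast τ (n+(k+1)) (n+1+k) (by omega) a
      rw [this, List.flatMap_assoc, List.flatMap_map]

theorem aux_sadic_zero : ∀ (k : ℕ) (a : A (0 + k)),
    sadicWordAux τ 0 k a = word0 τ k (cast (by congr 1; omega) a)
  | 0, a => rfl
  | k+1, a => by
      rw [sadicWordAux, funext (aux_sadic_zero k), word0]
      have := aux_cast τ (0+k) k (by omega) a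
      rw [this, List.flatMap_map]

theorem aux_mem_XLevel_zero (x : ℤ → A 0)
    (h : ∀ (i : ℤ) (m : ℕ), ∃ k : ℕ, 0 < k ∧ ∃ a : A k,
      (factorAt x i m).IsInfix (word0 τ k a)) : x ∈ XLevel τ 0 := by
  intro i m
  obtain ⟨k, hk, a, ha⟩ := h i m
  refine ⟨k, hk, cast (by congr 1; omega) a, ?_⟩
  rw [aux_sadic_zero]
  simpa using ha

end casts

section levels

variable {A : ℕ → Type} (τ : ∀ n, A (n+1) → List (A n))

/-- `x = S^k τ_n(y)` for a morphism of constant length `l`. -/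
def AuxRep {B C : Type} (f : B → List C) (l : ℕ) (x : ℤ → C) (y : ℤ → B) (k : ℕ) : Prop :=
  ∀ (j : ℤ) (s : ℕ), s < l → (f (y j))[s]? = some (x (l * j + s - k))

theorem AuxRep.centered {B C : Type} {f : B → List C} {l : ℕ} (hf : ∀ b, (f b).length = l)
    {x : ℤ → C} {y : ℤ → B} {k : ℕ} (h : AuxRep f l x y k) (hk : k < l)
    {Y : Set (ℤ → B)} (hy : y ∈ Y) : IsCenteredRep f Y x y k := by
  refine ⟨hy, by rw [hf]; exact hk, fun j => l * j, by simp, fun j => ?_, fun j m => ?_⟩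
  · simp only [hf]; ring
  · have hm : (m : ℕ) < l := by rw [← hf (y j)]; exact m.2
    have := h j m hm
    rw [List.getElem?_eq_getElem m.2] at this
    simpa using (Option.some.inj this).symm

theorem aux_desub (n l : ℕ) (hl : ∀ a, (τ n a).length = l) (hpos : 0 < l)
    [Finite (A (n+1))] [Nonempty (A (n+1))] (x : ℤ → A n) (hx : x ∈ XLevel τ n) :
    ∃ y ∈ XLevel τ (n+1), ∃ k < l, AuxRep (τ n) l x y k := by
  classical
  have H : ∀ m : ℕ, ∃ w : List (A (n+1)),
      (∃ k : ℕ, 0 < k ∧ ∃ a : A (n+1+k), w = sadicWordAux τ (n+1) k a) ∧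
      ∃ q : ℕ, ∀ i : ℤ, -(m:ℤ) ≤ i → i < m → 0 ≤ (q:ℤ) + i ∧
        (w.flatMap (τ n))[((q:ℤ) + i).toNat]? = some (x i) := by
    intro m
    obtain ⟨K, hK, a, ha⟩ := hx (-((m + l : ℕ) : ℤ)) (2 * (m + l))
    obtain ⟨K, rfl⟩ : ∃ K', K = K' + 1 := ⟨K - 1, by omega⟩
    rw [aux_sadic_succ, aux_factorAt_infix, aux_length_flatMap _ l hl] at ha
    obtain ⟨o, ho, h⟩ := ha
    have hK' : 0 < K := by
      rcases Nat.eq_zero_or_pos K with rfl | h0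
      · simp [sadicWordAux] at ho; omega
      · exact h0
    refine ⟨_, ⟨K, hK', cast (by congr 1; omega) a, rfl⟩, o + (m + l), fun i hi1 hi2 => ⟨by push_cast; omega, ?_⟩⟩
    have := h (i + (m + l : ℕ)).toNat (by omega)
    rw [show ((((o + (m + l) : ℕ)):ℤ) + i).toNat = o + (i + (m + l : ℕ)).toNat by omega, this]
    congr 2
    omega
  choose w hw q hq using H
  obtain ⟨k, hk⟩ := aux_ultra (fun m => (⟨q m % l, Nat.mod_lt _ hpos⟩ : Fin l))
  let d : ℕ → ℕ := fun m => q m / l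
  have hy : ∀ j : ℤ, ∃ b, ∀ᶠ m in (Filter.hyperfilter ℕ : Filter ℕ),
      ((w m)[((d m : ℤ) + j).toNat]?).getD (Classical.arbitrary _) = b :=
    fun j => aux_ultra _
  choose y hy using hy
  have hqd : ∀ᶠ m in (Filter.hyperfilter ℕ : Filter ℕ), q m = l * d m + k := by
    filter_upwards [hk] with m hm
    have : q m % l = k := congrArg Fin.val hm
    rw [← this]; exact (Nat.div_add_mod _ _).symm
  have key : ∀ j : ℤ, ∀ᶠ m in (Filter.hyperfilter ℕ : Filter ℕ),
      0 ≤ (d m : ℤ) + j ∧ (w m)[((d m : ℤ) + j).toNat]? = some (y j) := by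
    intro j
    filter_upwards [hy j, hqd, aux_ultra_ge ((l * j - k : ℤ).natAbs + 1)] with m h1 h2 h3
    obtain ⟨h4, h5⟩ := hq m (l * j - k) (by omega) (by omega)
    have e : (q m : ℤ) + (l * j - k) = l * ((d m : ℤ) + j) := by
      rw [h2]; push_cast; ring
    have h6 : 0 ≤ (d m : ℤ) + j := by
      rw [e] at h4
      exact nonneg_of_mul_nonneg_right h4 (by exact_mod_cast hpos)
    refine ⟨h6, ?_⟩
    obtain ⟨t, ht⟩ := Int.eq_ofNat_of_zero_le h6
    rw [e, ht, show ((l:ℤ) * (t:ℤ)).toNat = l * t + 0 by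
      rw [← Nat.cast_mul, Int.toNat_natCast]; rfl,
      aux_getElem?_flatMap _ l hl _ _ _ hpos] at h5
    rw [ht, Int.toNat_natCast] at h1 ⊢
    cases hc : (w m)[t]? with
    | none => rw [hc] at h5; simp at h5
    | some b => rw [hc] at h1; simpa using h1
  refine ⟨y, ?_, k, k.2, ?_⟩
  · intro i len
    have : ∀ᶠ m in (Filter.hyperfilter ℕ : Filter ℕ), ∀ j ∈ Finset.range (len+1),
        0 ≤ (d m : ℤ) + (i + j) ∧ (w m)[((d m : ℤ) + (i + j)).toNat]? = some (y (i + j)) :=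
      (Filter.eventually_all_finset _).2 fun j _ => key _
    obtain ⟨m, hm⟩ := this.exists
    obtain ⟨K, hK, a, hwa⟩ := hw m
    refine ⟨K, hK, a, ?_⟩
    rw [← hwa, aux_factorAt_infix]
    have h0 := (hm 0 (by simp)).1
    have e : ∀ j : ℕ, ((d m : ℤ) + (i + j)).toNat = ((d m : ℤ) + i).toNat + j := by
      intro j; simp at h0; omega
    refine ⟨((d m : ℤ) + i).toNat, ?_, fun j hj => ?_⟩
    · have := (hm len (by simp)).2
      rw [e] at this
      exact (List.getElem?_eq_some_iff.1 this).1.le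
    · have := (hm j (by simp; omega)).2
      rwa [e] at this
  · intro j s hs
    have : ∀ᶠ m in (Filter.hyperfilter ℕ : Filter ℕ),
        (τ n (y j))[s]? = some (x (l * j + s - (k : ℕ))) := by
      filter_upwards [key j, hqd, aux_ultra_ge ((l * j + s - k : ℤ).natAbs + 1)] with m h1 h2 h3
      obtain ⟨h4, h5⟩ := hq m (l * j + s - k) (by omega) (by omega)
      obtain ⟨h6, h7⟩ := h1
      have e : (q m : ℤ) + (l * j + s - k) = l * ((d m : ℤ) + j) + s := by
        rw [h2]; push_cast; ring
      obtain ⟨t, ht⟩ := Int.eq_ofNat_of_zero_le h6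
      rw [e, ht, show ((l:ℤ) * (t:ℤ) + s).toNat = l * t + s by
        rw [← Nat.cast_mul, ← Nat.cast_add, Int.toNat_natCast],
        aux_getElem?_flatMap _ l hl _ _ _ hs] at h5
      rw [ht, Int.toNat_natCast] at h7
      rw [h7] at h5
      simpa using h5
    exact this.exists.choose_spec

theorem aux_limit_mem (n : ℕ) (y Y : ℤ → A n) (hy : y ∈ XLevel τ n)
    (h : ∀ j : ℤ, ∀ᶠ m : ℕ in (Filter.hyperfilter ℕ : Filter ℕ), y (j - m) = Y j) :
    Y ∈ XLevel τ n := by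
  intro i len
  have : ∀ᶠ m : ℕ in (Filter.hyperfilter ℕ : Filter ℕ), ∀ j ∈ Finset.range len,
      y (i + j - m) = Y (i + j) :=
    (Filter.eventually_all_finset _).2 fun j _ => h _
  obtain ⟨m, hm⟩ := this.exists
  obtain ⟨K, hK, a, ha⟩ := hy (i - m) len
  refine ⟨K, hK, a, ?_⟩
  convert ha using 1
  rw [aux_factorAt_eq, aux_factorAt_eq]
  apply List.map_congr_left
  intro j hj
  rw [← hm j (by simpa using hj)]
  congr 1; ring

theorem aux_same_k (n l : ℕ) (hl : ∀ a, (τ n a).length = l) (hpos : 0 < l)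
    [Finite (A (n+1))] [Finite (A n)] (hrec : RecognizableIn (τ n) (XLevel τ (n+1)))
    (x x' : ℤ → A n) (hxx : ∀ i < 0, x i = x' i) (y y' : ℤ → A (n+1))
    (hy : y ∈ XLevel τ (n+1)) (hy' : y' ∈ XLevel τ (n+1)) (k k' : ℕ) (hk : k < l) (hk' : k' < l)
    (h : AuxRep (τ n) l x y k) (h' : AuxRep (τ n) l x' y' k') : k = k' := by
  have e1 : ∀ j : ℤ, ∃ b, ∀ᶠ m : ℕ in (Filter.hyperfilter ℕ : Filter ℕ), y (j - m) = b :=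
    fun j => aux_ultra _
  have e2 : ∀ j : ℤ, ∃ b, ∀ᶠ m : ℕ in (Filter.hyperfilter ℕ : Filter ℕ), y' (j - m) = b :=
    fun j => aux_ultra _
  have e3 : ∀ j : ℤ, ∃ b, ∀ᶠ m : ℕ in (Filter.hyperfilter ℕ : Filter ℕ), x (j - l * m) = b :=
    fun j => aux_ultra _
  choose Y hY using e1
  choose Y' hY' using e2
  choose Z hZ using e3
  have hZ' : ∀ j : ℤ, ∀ᶠ m : ℕ in (Filter.hyperfilter ℕ : Filter ℕ), x' (j - l * m) = Z j := by
    intro j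
    filter_upwards [hZ j, aux_ultra_ge (j.natAbs + 1)] with m h1 h2
    rw [← h1, hxx]
    have : (m : ℤ) ≤ l * m := by
      have : (1:ℤ) ≤ l := by exact_mod_cast hpos
      nlinarith
    omega
  have r : AuxRep (τ n) l Z Y k := by
    intro j s hs
    obtain ⟨m, h1, h2⟩ := ((hY j).and (hZ (l * j + s - k))).exists
    rw [← h1, ← h2, h _ _ hs]
    congr 2; ring
  have r' : AuxRep (τ n) l Z Y' k' := by
    intro j s hs
    obtain ⟨m, h1, h2⟩ := ((hY' j).and (hZ' (l * j + s - k'))).exists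
    rw [← h1, ← h2, h' _ _ hs]
    congr 2; ring
  have hfin := hrec Z Y Y' k k' (r.centered hl hk (aux_limit_mem τ _ y Y hy hY))
    (r'.centered hl hk' (aux_limit_mem τ _ y' Y' hy' hY'))
  exact hfin.2

/-- A centered left asymptotic pair at level `n` comes from one at level `n+1`. -/
theorem aux_step (n l d : ℕ) (hl : ∀ a, (τ n a).length = l) (hdl : d < l)
    [Finite (A (n+1))] [Nonempty (A (n+1))] [Finite (A n)]
    (hrec : RecognizableIn (τ n) (XLevel τ (n+1)))
    (hd1 : ∀ a b s, s < d → (τ n a)[s]? = (τ n b)[s]?)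
    (hd2 : ∀ a b, a ≠ b → (τ n a)[d]? ≠ (τ n b)[d]?)
    (x x' : ℤ → A n) (hx : x ∈ XLevel τ n) (hx' : x' ∈ XLevel τ n)
    (hc : CenteredLeftAsymptoticPair x x') :
    ∃ y ∈ XLevel τ (n+1), ∃ y' ∈ XLevel τ (n+1), CenteredLeftAsymptoticPair y y' ∧
      AuxRep (τ n) l x y d ∧ AuxRep (τ n) l x' y' d := by
  have hpos : 0 < l := by omega
  obtain ⟨y, hy, k, hk, r⟩ := aux_desub τ n l hl hpos x hx
  obtain ⟨y', hy', k', hk', r'⟩ := aux_desub τ n l hl hpos x' hx'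
  obtain rfl := aux_same_k τ n l hl hpos hrec x x' hc.1 y y' hy hy' k k' hk hk' r r'
  have h0 := r 0 k hk
  have h0' := r' 0 k hk
  simp only [mul_zero, zero_add, sub_self] at h0 h0'
  have hne : y 0 ≠ y' 0 := by
    intro h
    rw [h, h0'] at h0
    exact hc.2 (Option.some.inj h0).symm
  have hkd : k = d := by
    rcases lt_trichotomy k d with h | h | h
    · have := hd1 (y 0) (y' 0) k h
      rw [h0, h0'] at this
      exact absurd (Option.some.inj this) hc.2
    · exact h
    · exfalso
      apply hd2 _ _ hne
      rw [r 0 d hdl, r' 0 d hdl, hc.1]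
      simp; omega
  subst hkd
  refine ⟨y, hy, y', hy', ⟨fun j hj => ?_, hne⟩, r, r'⟩
  by_contra hne'
  apply hd2 _ _ hne'
  rw [r j k hk, r' j k hk, hc.1]
  have : (l:ℤ) * j < 0 := mul_neg_of_pos_of_neg (by exact_mod_cast hpos) hj
  omega

end levels

section main

/-- Length of `τ_{[0,n)}`. -/
def auxP (l : ℕ → ℕ) : ℕ → ℕ
  | 0 => 1
  | n+1 => auxP l n * l n

/-- Length of the common prefix of the words `τ_{[0,n)}(a)`. -/
def auxQ (l d : ℕ → ℕ) : ℕ → ℕ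
  | 0 => 0
  | n+1 => auxP l n * d n + auxQ l d n

variable {A : ℕ → Type} (τ : ∀ n, A (n+1) → List (A n))

theorem aux_word_len (l : ℕ → ℕ) (hl : ∀ n a, (τ n a).length = l n) :
    ∀ n a, (word0 τ n a).length = auxP l n
  | 0, a => rfl
  | n+1, a => by
      rw [word0, aux_length_flatMap _ _ (aux_word_len l hl n), hl, auxP]

theorem aux_word_get (l : ℕ → ℕ) (hl : ∀ n a, (τ n a).length = l n) (n : ℕ) (a : A (n+1))
    (q s : ℕ) (hs : s < auxP l n) :
    (word0 τ (n+1) a)[auxP l n * q + s]? =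
      ((τ n a)[q]?).bind (fun b => (word0 τ n b)[s]?) := by
  rw [word0, aux_getElem?_flatMap _ _ (aux_word_len τ l hl n) _ _ _ hs]

theorem auxP_pos (l : ℕ → ℕ) (h : ∀ n, 0 < l n) : ∀ n, 0 < auxP l n
  | 0 => Nat.one_pos
  | n+1 => Nat.mul_pos (auxP_pos l h n) (h n)

theorem auxP_ge (l : ℕ → ℕ) (h : ∀ n, 0 < l n) (h2 : ∀ n, 2 ≤ l (n+1)) :
    ∀ n, n ≤ auxP l n
  | 0 => Nat.zero_le _
  | 1 => auxP_pos l h 1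
  | n+2 => by
      have h1 := auxP_ge l h h2 (n+1)
      have h3 : auxP l (n+1) * 2 ≤ auxP l (n+1) * l (n+1) := Nat.mul_le_mul_left _ (h2 n)
      have h4 : auxP l (n+2) = auxP l (n+1) * l (n+1) := rfl
      omega

theorem auxQ_ge (l d : ℕ → ℕ) (hd : ∀ n, 1 ≤ d n) (hdl : ∀ n, d n + 2 ≤ l n) (n : ℕ) :
    n ≤ auxQ l d n ∧ auxQ l d n + n < auxP l n := by
  induction n with
  | zero => simp [auxQ, auxP]
  | succ n ih =>
    have e1 : auxP l (n+1) = auxP l n * l n := rfl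
    have e2 : auxQ l d (n+1) = auxP l n * d n + auxQ l d n := rfl
    have h1 : auxP l n * 1 ≤ auxP l n * d n := Nat.mul_le_mul_left _ (hd n)
    have h2 : auxP l n * (d n + 2) ≤ auxP l n * l n := Nat.mul_le_mul_left _ (hdl n)
    rw [Nat.mul_add] at h2
    omega

/-- If one of the morphisms is constant then there is a periodic point. -/
theorem aux_nonconst [∀ n, Nonempty (A (n+1))] (l : ℕ → ℕ) (hl : ∀ n a, (τ n a).length = l n)
    (h : ∀ n, 0 < l n) (h2 : ∀ n, 2 ≤ l (n+1))
    (hap : ∀ x ∈ XLevel τ 0, IsAperiodicPoint x) (n : ℕ) :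
    ¬ ∀ a b : A (n+1), τ n a = τ n b := by
  intro hc
  obtain ⟨c⟩ := (inferInstance : Nonempty (A (n+1)))
  set V := word0 τ (n+1) c with hV
  have hVl : V.length = auxP l (n+1) := aux_word_len τ l hl _ _
  have hPp : 0 < auxP l (n+1) := auxP_pos l h _
  have hdvd : ∀ k, auxP l (n+1) ∣ auxP l (n+1+k) := by
    intro k
    induction k with
    | zero => exact dvd_rfl
    | succ k ih => exact Dvd.dvd.mul_right ih _
  have key : ∀ k (a : A (n+1+k)) s, s < auxP l (n+1+k) →
      (word0 τ (n+1+k) a)[s]? = V[s % auxP l (n+1)]? := by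
    intro k
    induction k with
    | zero =>
      intro a s hs
      rw [Nat.mod_eq_of_lt hs, hV]
      congr 1
      simp only [word0]
      rw [hc a c]
    | succ k ih =>
      intro a s hs
      have hP := auxP_pos l h (n+1+k)
      have hq : s / auxP l (n+1+k) < (τ (n+1+k) a).length := by
        rw [hl]; exact Nat.div_lt_of_lt_mul hs
      have := aux_word_get τ l hl (n+1+k) a (s / auxP l (n+1+k)) (s % auxP l (n+1+k))
        (Nat.mod_lt _ hP)
      rw [Nat.div_add_mod, List.getElem?_eq_getElem hq, Option.bind_some,
        ih _ _ (Nat.mod_lt _ hP), Nat.mod_mod_of_dvd _ (hdvd k)] at this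
      exact this
  have hlt : ∀ i : ℤ, (i % (auxP l (n+1) : ℤ)).toNat < V.length := by
    intro i
    have := Int.emod_lt_of_pos i (show (0:ℤ) < auxP l (n+1) by exact_mod_cast hPp)
    rw [hVl]; omega
  let x : ℤ → A 0 := fun i => V[(i % (auxP l (n+1) : ℤ)).toNat]'(hlt i)
  have hx : x ∈ XLevel τ 0 := by
    apply aux_mem_XLevel_zero
    intro i m
    obtain ⟨a⟩ := (inferInstance : Nonempty (A (n + (m + auxP l (n+1)) + 1)))
    have : ∃ a : A (n + 1 + (m + auxP l (n+1))), True :=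
      ⟨cast (by congr 1; omega) a, trivial⟩
    obtain ⟨a, -⟩ := this
    refine ⟨n + 1 + (m + auxP l (n+1)), by omega, a, ?_⟩
    rw [aux_factorAt_infix]
    have h0 := Int.emod_nonneg i (show (auxP l (n+1) : ℤ) ≠ 0 by positivity)
    have h1 := Int.emod_lt_of_pos i (show (0:ℤ) < auxP l (n+1) by exact_mod_cast hPp)
    have h3 := auxP_ge l h h2 (n + 1 + (m + auxP l (n+1)))
    refine ⟨(i % (auxP l (n+1) : ℤ)).toNat, ?_, fun j hj => ?_⟩
    · rw [aux_word_len τ l hl]; omega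
    · rw [key _ _ _ (by omega)]
      simp only [x]
      rw [← List.getElem?_eq_getElem]
      congr 1
      zify
      rw [Int.toNat_of_nonneg h0, Int.toNat_of_nonneg (Int.emod_nonneg _ (by positivity)),
        Int.emod_add_emod]
  refine hap x hx ⟨auxP l (n+1), hPp, fun i => ?_⟩
  simp only [x, Int.add_emod_right]

theorem aux_word_prefix (l d : ℕ → ℕ) (hl : ∀ n a, (τ n a).length = l n)
    (hdl : ∀ n, d n < l n) (hQ : ∀ n, auxQ l d n < auxP l n)
    (hd1 : ∀ n a b s, s < d n → (τ n a)[s]? = (τ n b)[s]?)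
    (hd2 : ∀ n a b, a ≠ b → (τ n a)[d n]? ≠ (τ n b)[d n]?) (n : ℕ) :
    (∀ a b s, s < auxQ l d n → (word0 τ n a)[s]? = (word0 τ n b)[s]?) ∧
    (∀ a b, a ≠ b → (word0 τ n a)[auxQ l d n]? ≠ (word0 τ n b)[auxQ l d n]?) := by
  induction n with
  | zero => simp [auxQ, word0]
  | succ n ih =>
    have hda : ∀ a, d n < (τ n a).length := fun a => by rw [hl]; exact hdl n
    have hP : 0 < auxP l n := (Nat.zero_le _).trans_lt (hQ n)
    constructor
    · intro a b s hs
      rw [auxQ] at hs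
      have hr := Nat.mod_lt s hP
      have hdm := Nat.div_add_mod s (auxP l n)
      rw [← hdm, aux_word_get τ l hl _ _ _ _ hr, aux_word_get τ l hl _ _ _ _ hr]
      rcases lt_or_ge (s / auxP l n) (d n) with hlt | hge
      · rw [hd1 n a b _ hlt]
      · have hle : auxP l n * d n ≤ auxP l n * (s / auxP l n) := Nat.mul_le_mul_left _ hge
        have hr' : s % auxP l n < auxQ l d n := by omega
        have heq : s / auxP l n = d n := by
          have : s / auxP l n < d n + 1 := by
            apply Nat.div_lt_of_lt_mul
            rw [Nat.mul_add]; have := hQ n; omega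
          omega
        rw [heq, List.getElem?_eq_getElem (hda a), List.getElem?_eq_getElem (hda b)]
        exact ih.1 _ _ _ hr'
    · intro a b hab
      rw [auxQ, aux_word_get τ l hl _ _ _ _ (hQ n), aux_word_get τ l hl _ _ _ _ (hQ n),
        List.getElem?_eq_getElem (hda a), List.getElem?_eq_getElem (hda b)]
      apply ih.2
      intro h
      apply hd2 n a b hab
      rw [List.getElem?_eq_getElem (hda a), List.getElem?_eq_getElem (hda b), h]

/-- Iteration of `aux_step`. -/
theorem aux_iter (l d : ℕ → ℕ) (hl : ∀ n a, (τ n a).length = l n)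
    (hdl : ∀ n, d n < l n) [∀ n, Finite (A n)] [∀ n, Nonempty (A (n+1))]
    (hRec : RecognizableSeq τ)
    (hd1 : ∀ n a b s, s < d n → (τ n a)[s]? = (τ n b)[s]?)
    (hd2 : ∀ n a b, a ≠ b → (τ n a)[d n]? ≠ (τ n b)[d n]?)
    (x x' : ℤ → A 0) (hx : x ∈ XLevel τ 0) (hx' : x' ∈ XLevel τ 0)
    (hc : CenteredLeftAsymptoticPair x x') (n : ℕ) :
    ∃ y ∈ XLevel τ n, ∃ y' ∈ XLevel τ n, CenteredLeftAsymptoticPair y y' ∧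
      AuxRep (word0 τ n) (auxP l n) x y (auxQ l d n) ∧
      AuxRep (word0 τ n) (auxP l n) x' y' (auxQ l d n) := by
  induction n with
  | zero =>
    refine ⟨x, hx, x', hx', hc, ?_, ?_⟩ <;>
    · intro j s hs
      obtain rfl : s = 0 := by simp [auxP] at hs; exact hs
      simp [word0, auxP, auxQ]
  | succ n ih =>
    obtain ⟨y, hy, y', hy', hcy, r, r'⟩ := ih
    obtain ⟨z, hz, z', hz', hcz, t, t'⟩ := aux_step τ n (l n) (d n) (hl n) (hdl n) (hRec n)
      (hd1 n) (hd2 n) y y' hy hy' hcy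
    have gen : ∀ (x : ℤ → A 0) (y : ℤ → A n) (z : ℤ → A (n+1)),
        AuxRep (word0 τ n) (auxP l n) x y (auxQ l d n) → AuxRep (τ n) (l n) y z (d n) →
        AuxRep (word0 τ (n+1)) (auxP l (n+1)) x z (auxQ l d (n+1)) := by
      intro x y z r t j s hs
      have hP : 0 < auxP l n := by
        rcases Nat.eq_zero_or_pos (auxP l n) with h | h
        · simp [auxP, h] at hs
        · exact h
      have hr := Nat.mod_lt s hP
      have hdm := Nat.div_add_mod s (auxP l n)
      rw [← hdm, aux_word_get τ l hl _ _ _ _ hr,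
        t j _ (Nat.div_lt_of_lt_mul hs), Option.bind_some, r _ _ hr]
      congr 2
      simp only [auxP, auxQ]
      push_cast
      ring
    have g1 := gen x y z r t
    have g2 := gen x' y' z' r' t'
    exact ⟨z, hz, z', hz', hcz, g1, g2⟩

/-- A sequence built from a compatible family of letters. -/
theorem aux_build (l d : ℕ → ℕ) (hl : ∀ n a, (τ n a).length = l n)
    (hQ : ∀ n, n ≤ auxQ l d n ∧ auxQ l d n + n < auxP l n)
    (a : ∀ n, A n) (ha : ∀ n, (τ n (a (n+1)))[d n]? = some (a n)) :
    ∃ x ∈ XLevel τ 0, ∀ n s, s < auxP l n →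
      (word0 τ n (a n))[s]? = some (x ((s : ℤ) - auxQ l d n)) := by
  have step : ∀ n s, s < auxP l n →
      (word0 τ (n+1) (a (n+1)))[auxP l n * d n + s]? = (word0 τ n (a n))[s]? := by
    intro n s hs
    rw [aux_word_get τ l hl _ _ _ _ hs, ha, Option.bind_some]
  have hlen : ∀ n, (word0 τ n (a n)).length = auxP l n := fun n => aux_word_len τ l hl n _
  have steps : ∀ n k (i : ℤ), 0 ≤ i + auxQ l d n → i + auxQ l d n < auxP l n →
      0 ≤ i + auxQ l d (n+k) ∧ i + auxQ l d (n+k) < auxP l (n+k) ∧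
      (word0 τ (n+k) (a (n+k)))[(i + auxQ l d (n+k)).toNat]? =
        (word0 τ n (a n))[(i + auxQ l d n).toNat]? := by
    intro n k i h0 h1
    induction k with
    | zero => exact ⟨h0, h1, rfl⟩
    | succ k ih =>
      obtain ⟨i0, i1, i2⟩ := ih
      have hs := step (n+k) (i + auxQ l d (n+k)).toNat (by omega)
      have e : (i + auxQ l d (n+(k+1))).toNat =
          auxP l (n+k) * d (n+k) + (i + auxQ l d (n+k)).toNat := by
        have : auxQ l d (n+(k+1)) = auxP l (n+k) * d (n+k) + auxQ l d (n+k) := rfl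
        omega
      have e' : (auxQ l d (n+(k+1)) : ℤ) = auxP l (n+k) * d (n+k) + auxQ l d (n+k) := by
        have : auxQ l d (n+(k+1)) = auxP l (n+k) * d (n+k) + auxQ l d (n+k) := rfl
        rw [this]; push_cast; rfl
      have hnn : (0:ℤ) ≤ auxP l (n+k) * d (n+k) := by positivity
      have e3 := (hQ (n+(k+1)))
      have hm : (word0 τ (n+(k+1)) (a (n+(k+1))))[(i + auxQ l d (n+(k+1))).toNat]? =
        (word0 τ n (a n))[(i + auxQ l d n).toNat]? := by
        rw [e, ← i2]; exact hs
      refine ⟨by omega, ?_, hm⟩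
      rw [List.getElem?_eq_getElem (l := word0 τ n (a n)) (by rw [hlen]; omega)] at hm
      have := (List.getElem?_eq_some_iff.1 hm).1
      rw [hlen] at this
      omega
  have hin : ∀ i : ℤ, (i + auxQ l d i.natAbs).toNat < (word0 τ i.natAbs (a i.natAbs)).length := by
    intro i
    have := hQ i.natAbs
    rw [hlen]; omega
  let x : ℤ → A 0 := fun i => (word0 τ i.natAbs (a i.natAbs))[(i + auxQ l d i.natAbs).toNat]'(hin i)
  have main : ∀ n s, s < auxP l n →
      (word0 τ n (a n))[s]? = some (x ((s : ℤ) - auxQ l d n)) := by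
    intro n s hs
    set i : ℤ := (s : ℤ) - auxQ l d n with hi
    have q1 := hQ i.natAbs
    obtain ⟨-, -, h1⟩ := steps n i.natAbs i (by omega) (by omega)
    obtain ⟨-, -, h2⟩ := steps i.natAbs n i (by omega) (by omega)
    have e : ∀ m m' (h : m = m'), (word0 τ m (a m))[(i + auxQ l d m).toNat]? =
        (word0 τ m' (a m'))[(i + auxQ l d m').toNat]? := by rintro m _ rfl; rfl
    rw [e _ _ (Nat.add_comm n i.natAbs), h2] at h1
    rw [show (i + auxQ l d n).toNat = s by omega] at h1
    rw [← h1]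
    exact List.getElem?_eq_getElem _
  refine ⟨x, aux_mem_XLevel_zero τ x fun i m => ?_, main⟩
  have q := hQ (i.natAbs + m + 1)
  refine ⟨i.natAbs + m + 1, by omega, a _, ?_⟩
  rw [aux_factorAt_infix]
  refine ⟨(i + auxQ l d (i.natAbs + m + 1)).toNat, by rw [hlen]; omega, fun j hj => ?_⟩
  rw [main _ _ (by omega)]
  congr 2
  omega

end main

section final

variable {A : ℕ → Type} (τ : ∀ n, A (n+1) → List (A n))

theorem aux_len_two (l : ℕ → ℕ) (hl : ∀ n a, (τ n a).length = l n) (hpos : ∀ n, 0 < l n)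
    (hPrim : PrimitiveSeq τ) (hProp : ProperSeq τ) [∀ n, Nonempty (A (n+1))]
    (n : ℕ) (hnt : Nontrivial (A n)) : 2 ≤ l n := by
  by_contra hlt
  have h1 : l n = 1 := by have := hpos n; omega
  obtain ⟨b, c, hbc⟩ := hProp n
  obtain ⟨b', hb'⟩ := exists_ne b
  obtain ⟨k, hk, hmem⟩ := hPrim n
  obtain ⟨k, rfl⟩ : ∃ k', k = k' + 1 := ⟨k - 1, by omega⟩
  obtain ⟨a⟩ := (inferInstance : Nonempty (A (n + k + 1)))
  have := hmem a b'
  rw [aux_sadic_succ, List.mem_flatMap] at this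
  obtain ⟨e, -, he⟩ := this
  obtain ⟨z, hz⟩ := List.length_eq_one_iff.1 ((hl n e).trans h1)
  have := (hbc e).1
  rw [hz] at this he
  simp at this he
  exact hb' (he.trans this)

theorem aux_exists_d (l : ℕ) (n : ℕ) (hl : ∀ a, (τ n a).length = l)
    (hprop : ∃ b c : A n, ∀ a : A (n+1), (τ n a).head? = some b ∧ (τ n a).getLast? = some c)
    (u v : A (n+1)) (huv : ∀ a, a = u ∨ a = v) (hne : ¬ ∀ a b : A (n+1), τ n a = τ n b) :
    ∃ d, 1 ≤ d ∧ d + 2 ≤ l ∧ (∀ a b s, s < d → (τ n a)[s]? = (τ n b)[s]?) ∧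
      ∀ a b, a ≠ b → (τ n a)[d]? ≠ (τ n b)[d]? := by
  classical
  have hd : ∃ d : ℕ, (τ n u)[d]? ≠ (τ n v)[d]? := by
    by_contra hcon
    push Not at hcon
    have he : τ n u = τ n v := List.ext_getElem? hcon
    apply hne
    intro a b
    rcases huv a with rfl | rfl <;> rcases huv b with rfl | rfl <;> simp [he]
  obtain ⟨b, c, hbc⟩ := hprop
  have hmin : ∀ s, s < Nat.find hd → (τ n u)[s]? = (τ n v)[s]? := fun s hs => by
    have := Nat.find_min hd hs
    simpa using this
  have hspec := Nat.find_spec hd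
  set D := Nat.find hd with hD
  refine ⟨D, ?_, ?_, ?_, ?_⟩
  · rcases Nat.eq_zero_or_pos D with h0 | h0
    · rw [h0, ← List.head?_eq_getElem?, ← List.head?_eq_getElem?, (hbc u).1, (hbc v).1] at hspec
      exact absurd rfl hspec
    · exact h0
  · by_contra hlt
    rcases Nat.lt_or_ge D l with h1 | h1
    · have h2 : D = l - 1 := by omega
      have e : ∀ a, (τ n a)[D]? = some c := by
        intro a
        rw [← (hbc a).2, List.getLast?_eq_getElem?, hl, h2]
      rw [e, e] at hspec
      exact hspec rfl
    · rw [List.getElem?_eq_none (by rw [hl]; exact h1),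
        List.getElem?_eq_none (by rw [hl]; exact h1)] at hspec
      exact hspec rfl
  · intro a b s hs
    rcases huv a with rfl | rfl <;> rcases huv b with rfl | rfl <;> simp [hmin s hs]
  · intro a b hab
    rcases huv a with rfl | rfl <;> rcases huv b with rfl | rfl
    · exact absurd rfl hab
    · exact hspec
    · exact hspec.symm
    · exact absurd rfl hab

/-- A compatible family of letters ending in a given letter of `A 1`. -/
theorem aux_letters (d : ℕ → ℕ)
    (hsurj : ∀ n, ∀ b : A (n+1), ∃ a, (τ (n+1) a)[d (n+1)]? = some b)
    (b : A 1) (b0 : A 0) (hb : (τ 0 b)[d 0]? = some b0) :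
    ∃ a : ∀ n, A n, a 1 = b ∧ ∀ n, (τ n (a (n+1)))[d n]? = some (a n) := by
  choose g hg using hsurj
  let a' : ∀ n, A (n+1) := fun n => Nat.rec (motive := fun n => A (n+1)) b (fun n c => g n c) n
  refine ⟨fun n => Nat.casesOn (motive := A) n b0 a', rfl, fun n => ?_⟩
  cases n with
  | zero => exact hb
  | succ n => exact hg n (a' n)

end final

/-- For a constant-length, primitive, proper and recognizable directive
sequence on 2-letter alphabets generating an aperiodic subshift, there is exactly one
centered left asymptotic pair in `X_τ`, and its two members are periodic at every
negative coordinate. -/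
theorem statement0 (A : ℕ → Type) [∀ n, Fintype (A n)]
    (τ : ∀ n, A (n+1) → List (A n))
    (hNE : NonErasing τ) (hCL : ConstantLength τ) (hPrim : PrimitiveSeq τ)
    (hProp : ProperSeq τ) (hRec : RecognizableSeq τ)
    (hcard : ∀ n, Fintype.card (A (n+1)) = 2)
    (hap : ∀ x ∈ XLevel τ 0, IsAperiodicPoint x) :
    ∃ x x' : ℤ → A 0, x ∈ XLevel τ 0 ∧ x' ∈ XLevel τ 0 ∧
      CenteredLeftAsymptoticPair x x' ∧
      (∀ y y' : ℤ → A 0, y ∈ XLevel τ 0 → y' ∈ XLevel τ 0 →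
        CenteredLeftAsymptoticPair y y' → ({y, y'} : Set (ℤ → A 0)) = {x, x'}) ∧
      (∀ i : ℤ, i < 0 → i ∈ PerAll x ∧ i ∈ PerAll x') := by
  classical
  have hN : ∀ n, Nonempty (A (n+1)) := fun n =>
    Fintype.card_pos_iff.1 (by rw [hcard]; norm_num)
  have hNT : ∀ n, Nontrivial (A (n+1)) := fun n =>
    Fintype.one_lt_card_iff_nontrivial.1 (by rw [hcard]; norm_num)
  have hl' : ∀ n, ∃ m, ∀ a, (τ n a).length = m := fun n =>
    ⟨(τ n (Classical.arbitrary _)).length, fun a => hCL n _ _⟩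
  choose l hl using hl'
  have hpos : ∀ n, 0 < l n := fun n => by
    rw [← hl n (Classical.arbitrary _)]
    exact List.length_pos_iff.2 (hNE n _)
  have h2 : ∀ n, 2 ≤ l (n+1) := fun n =>
    aux_len_two τ l hl hpos hPrim hProp (n+1) (hNT n)
  have hcov : ∀ n (u v : A (n+1)), u ≠ v → ∀ a, a = u ∨ a = v := by
    intro n u v huv a
    have : ({u, v} : Finset (A (n+1))) = Finset.univ :=
      Finset.eq_univ_of_card _ (by rw [Finset.card_pair huv, hcard])
    have ha : a ∈ ({u, v} : Finset (A (n+1))) := by rw [this]; exact Finset.mem_univ a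
    simpa using ha
  have hd' : ∀ n, ∃ d, 1 ≤ d ∧ d + 2 ≤ l n ∧
      (∀ a b s, s < d → (τ n a)[s]? = (τ n b)[s]?) ∧
      ∀ a b, a ≠ b → (τ n a)[d]? ≠ (τ n b)[d]? := by
    intro n
    obtain ⟨u, v, huv⟩ := exists_pair_ne (A (n+1))
    exact aux_exists_d τ (l n) n (hl n) (hProp n) u v (hcov n u v huv)
      (aux_nonconst τ l hl hpos h2 hap n)
  choose d hd0 hdl2 hd1 hd2 using hd'
  have hdl : ∀ n, d n < l n := fun n => by have := hdl2 n; omega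
  have hQ := auxQ_ge l d hd0 hdl2
  have hQ' : ∀ n, auxQ l d n < auxP l n := fun n => by have := hQ n; omega
  have hW := aux_word_prefix τ l d hl hdl hQ' hd1 hd2
  have hsome : ∀ n a, ∃ b, (τ n a)[d n]? = some b := fun n a =>
    ⟨_, List.getElem?_eq_getElem (by rw [hl]; exact hdl n)⟩
  have hsurj : ∀ n, ∀ b : A (n+1), ∃ a, (τ (n+1) a)[d (n+1)]? = some b := by
    intro n b
    obtain ⟨u, v, huv⟩ := exists_pair_ne (A (n+1+1))
    obtain ⟨bu, hu⟩ := hsome (n+1) u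
    obtain ⟨bv, hv⟩ := hsome (n+1) v
    have hne : bu ≠ bv := by
      rintro rfl
      exact hd2 (n+1) u v huv (hu.trans hv.symm)
    rcases hcov n bu bv hne b with rfl | rfl
    · exact ⟨u, hu⟩
    · exact ⟨v, hv⟩
  obtain ⟨u, v, huv⟩ := exists_pair_ne (A 1)
  obtain ⟨u0, hu0⟩ := hsome 0 u
  obtain ⟨v0, hv0⟩ := hsome 0 v
  obtain ⟨a, ha1, ha⟩ := aux_letters τ d hsurj u u0 hu0
  obtain ⟨b, hb1, hb⟩ := aux_letters τ d hsurj v v0 hv0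
  obtain ⟨x, hx, hxa⟩ := aux_build τ l d hl hQ a ha
  obtain ⟨x', hx', hxb⟩ := aux_build τ l d hl hQ b hb
  -- sequences determined by their value at `0`
  have huniq : ∀ y z : ℤ → A 0,
      (∀ n, ∃ c, ∀ s, s < auxP l n →
        (word0 τ n c)[s]? = some (y ((s : ℤ) - auxQ l d n))) →
      (∀ n, ∃ c, ∀ s, s < auxP l n →
        (word0 τ n c)[s]? = some (z ((s : ℤ) - auxQ l d n))) →
      y 0 = z 0 → y = z := by
    intro y z hy hz h0
    funext i
    obtain ⟨c, hc⟩ := hy i.natAbs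
    obtain ⟨c', hc'⟩ := hz i.natAbs
    have q := hQ i.natAbs
    have hcc : c = c' := by
      by_contra hne
      apply (hW i.natAbs).2 c c' hne
      rw [hc _ (hQ' _), hc' _ (hQ' _), sub_self, h0]
    subst hcc
    have e1 := hc (i + auxQ l d i.natAbs).toNat (by omega)
    have e2 := hc' (i + auxQ l d i.natAbs).toNat (by omega)
    rw [e1] at e2
    have e3 := Option.some.inj e2
    rwa [show (((i + auxQ l d i.natAbs).toNat : ℤ) - auxQ l d i.natAbs) = i by omega] at e3
  have hclap : CenteredLeftAsymptoticPair x x' := by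
    constructor
    · intro i hi
      have q := hQ i.natAbs
      have e := (hW i.natAbs).1 (a _) (b _) (i + auxQ l d i.natAbs).toNat (by omega)
      rw [hxa _ _ (by omega), hxb _ _ (by omega)] at e
      have e3 := Option.some.inj e
      rwa [show (((i + auxQ l d i.natAbs).toNat : ℤ) - auxQ l d i.natAbs) = i by omega] at e3
    · intro h0
      apply (hW 1).2 (a 1) (b 1) (by rw [ha1, hb1]; exact huv)
      rw [hxa _ _ (hQ' 1), hxb _ _ (hQ' 1), sub_self, h0]
  refine ⟨x, x', hx, hx', hclap, ?_, ?_⟩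
  · intro y y' hy hy' hc
    have hit := aux_iter τ l d hl hdl hRec hd1 hd2 y y' hy hy' hc
    have py : ∀ n, ∃ c, ∀ s, s < auxP l n →
        (word0 τ n c)[s]? = some (y ((s : ℤ) - auxQ l d n)) := by
      intro n
      obtain ⟨z, -, z', -, -, r, -⟩ := hit n
      exact ⟨z 0, fun s hs => by simpa using r 0 s hs⟩
    have py' : ∀ n, ∃ c, ∀ s, s < auxP l n →
        (word0 τ n c)[s]? = some (y' ((s : ℤ) - auxQ l d n)) := by
      intro n
      obtain ⟨z, -, z', -, -, -, r⟩ := hit n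
      exact ⟨z' 0, fun s hs => by simpa using r 0 s hs⟩
    have px : ∀ n, ∃ c, ∀ s, s < auxP l n →
        (word0 τ n c)[s]? = some (x ((s : ℤ) - auxQ l d n)) := fun n => ⟨a n, hxa n⟩
    have px' : ∀ n, ∃ c, ∀ s, s < auxP l n →
        (word0 τ n c)[s]? = some (x' ((s : ℤ) - auxQ l d n)) := fun n => ⟨b n, hxb n⟩
    have dich : ∀ z : ℤ → A 0, (∀ n, ∃ c, ∀ s, s < auxP l n →
        (word0 τ n c)[s]? = some (z ((s : ℤ) - auxQ l d n))) → z = x ∨ z = x' := by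
      intro z pz
      obtain ⟨c, hc⟩ := pz 1
      have e := hc _ (hQ' 1)
      rcases hcov 0 u v huv c with rfl | rfl
      · left
        apply huniq z x pz px
        have e' := hxa 1 _ (hQ' 1)
        rw [ha1, e, sub_self] at e'
        exact Option.some.inj e'
      · right
        apply huniq z x' pz px'
        have e' := hxb 1 _ (hQ' 1)
        rw [hb1, e, sub_self] at e'
        exact Option.some.inj e'
    have hne : y ≠ y' := fun h => hc.2 (by rw [h])
    rcases dich y py with rfl | rfl <;> rcases dich y' py' with rfl | rfl
    · exact absurd rfl hne
    · rfl
    · exact Set.pair_comm _ _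
    · exact absurd rfl hne
  · intro i hi
    have q := hQ i.natAbs
    have hper : ∀ (w : ℤ → A 0) (z : ℤ → A i.natAbs),
        AuxRep (word0 τ i.natAbs) (auxP l i.natAbs) w z (auxQ l d i.natAbs) →
        i ∈ PerAll w := by
      intro w z r
      refine ⟨auxP l i.natAbs, by omega, fun k => ?_⟩
      have e1 := r k (i + auxQ l d i.natAbs).toNat (by omega)
      have e2 := r 0 (i + auxQ l d i.natAbs).toNat (by omega)
      rw [(hW i.natAbs).1 (z k) (z 0) _ (by omega), e2] at e1
      have e3 := (Option.some.inj e1).symm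
      have t : ((i + auxQ l d i.natAbs).toNat : ℤ) = i + auxQ l d i.natAbs := by omega
      rw [t] at e3
      convert e3 using 2 <;> ring
    obtain ⟨z, -, z', -, -, r, r'⟩ :=
      aux_iter τ l d hl hdl hRec hd1 hd2 x x' hx hx' hclap i.natAbs
    exact ⟨hper x z r, hper x' z' r'⟩

end ToeplitzFR
end

section
/- Let τ = (τ_n : A_{n+1}* → A_n*)_{n≥0} be a primitive, proper and recognizable directive sequence of finite alphabet rank (liminf_n |A_n| < ∞), and suppose X_τ is an aperiodic Toeplitz subshift. For each i ≥ 0 let d_i = gcd{ |τ_{[0,i+1)}(a)| : a ∈ A_{i+1} }. Then: (i) every essential period of X_τ divides d_i for some i; and (ii) for every i, d_i divides some essential period of X_τ. (Equivalently, lcm(d_i)_{i≥0} is the scale of X_τ.) -/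
namespace ToeplitzFR

open Set

variable {A B C : Type*}

/-! ### Auxiliary material for the proof -/

/-- `z` is a concatenation of the words `σ (y j)`, placed at positions `c j`. -/
def Rep (σ : B → List C) (y : ℤ → B) (c : ℤ → ℤ) (z : ℤ → C) : Prop :=
  (∀ j, c (j+1) = c j + (σ (y j)).length) ∧
  ∀ j (m : ℕ), m < (σ (y j)).length → (σ (y j))[m]? = some (z (c j + m))

lemma exists_cum (f : ℤ → ℤ) (a : ℤ) :
    ∃ c : ℤ → ℤ, c 0 = a ∧ ∀ j, c (j+1) = c j + f j := by
  refine ⟨fun j => a + ∑ i ∈ Finset.range j.toNat, f i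
    - ∑ i ∈ Finset.range (-j).toNat, f (-(i:ℤ)-1), by simp, ?_⟩
  intro j
  rcases le_or_gt 0 j with h | h
  · obtain ⟨n, rfl⟩ := Int.eq_ofNat_of_zero_le h
    have h1 : ((n:ℤ)+1).toNat = n + 1 := by omega
    have h2 : (-((n:ℤ)+1)).toNat = 0 := by omega
    have h3 : (-(n:ℤ)).toNat = 0 := by omega
    simp only [h1, h2, h3, Finset.sum_range_succ, Int.toNat_natCast]
    simp; ring
  · obtain ⟨n, hn⟩ := Int.eq_ofNat_of_zero_le (show 0 ≤ -j - 1 by omega)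
    obtain rfl : j = -(n:ℤ) - 1 := by omega
    have h1 : (-(n:ℤ)-1+1).toNat = 0 := by omega
    have h2 : (-(n:ℤ)-1).toNat = 0 := by omega
    have h3 : (-(-(n:ℤ)-1+1)).toNat = n := by omega
    have h4 : (-(-(n:ℤ)-1)).toNat = n+1 := by omega
    simp only [h1, h2, h3, h4, Finset.sum_range_succ]
    simp; ring

lemma strict_add {c : ℤ → ℤ} (hc : StrictMono c) {j k : ℤ} (h : j ≤ k) :
    c j + (k - j) ≤ c k := by
  induction k, h using Int.leInduction with
  | base => simp
  | succ k hk ih =>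
    have := hc (show k < k+1 by omega)
    omega

lemma find_block {c : ℤ → ℤ} (hc : StrictMono c) (n : ℤ) :
    ∃ j, c j ≤ n ∧ n < c (j+1) := by
  obtain ⟨j, h1, h2⟩ := Int.exists_greatest_of_bdd (P := fun j => c j ≤ n)
    ⟨max 0 (n - c 0), fun z hz => by
      rcases le_or_gt z 0 with h | h
      · exact le_max_of_le_left h
      · have := strict_add hc h.le
        apply le_max_of_le_right; omega⟩
    ⟨min 0 (n - c 0), by
      have := strict_add hc (min_le_left 0 (n - c 0))
      have := min_le_right 0 (n - c 0)
      omega⟩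
  refine ⟨j, h1, ?_⟩
  by_contra h
  have := h2 (j+1) (by omega)
  omega

lemma Rep.strictMono {σ : B → List C} (hσ : ∀ a, σ a ≠ []) {y : ℤ → B} {c : ℤ → ℤ}
    (h : ∀ j, c (j+1) = c j + (σ (y j)).length) : StrictMono c := by
  apply strictMono_int_of_lt_succ
  intro j
  rw [h j]
  have := List.length_pos_of_ne_nil (hσ (y j))
  omega

lemma block_unique {c : ℤ → ℤ} (hc : StrictMono c) {n j k : ℤ}
    (h1 : c j ≤ n) (h2 : n < c (j+1)) (h3 : c k ≤ n) (h4 : n < c (k+1)) : j = k := by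
  have := hc.lt_iff_lt.1 (h1.trans_lt h4)
  have := hc.lt_iff_lt.1 (h3.trans_lt h2)
  omega

lemma concat_exists {σ : B → List C} (hσ : ∀ a, σ a ≠ []) (y : ℤ → B) :
    ∃ c z, c 0 = 0 ∧ Rep σ y c z := by
  obtain ⟨c, h0, hc⟩ := exists_cum (fun j => ((σ (y j)).length : ℤ)) 0
  have hm : StrictMono c := Rep.strictMono hσ hc
  choose J hJ1 hJ2 using find_block hm
  have hlt : ∀ n, (n - c (J n)).toNat < (σ (y (J n))).length := by
    intro n
    have := hJ1 n; have := hJ2 n; have := hc (J n)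
    omega
  refine ⟨c, fun n => (σ (y (J n)))[(n - c (J n)).toNat]'(hlt n), h0, hc, ?_⟩
  intro j m hm'
  have e : J (c j + m) = j := block_unique hm (hJ1 _) (hJ2 _) (by omega)
    (by rw [hc j]; omega)
  have e2 : (c j + (m:ℤ) - c (J (c j + m))).toNat = m := by rw [e]; omega
  rw [List.getElem?_eq_getElem hm']
  congr 1
  simp only [e]
  congr 1
  omega

lemma cum_list {σ : B → List C} {y : ℤ → B} {c : ℤ → ℤ}
    (hc : ∀ j, c (j+1) = c j + (σ (y j)).length) (l : List B) (i : ℤ)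
    (hl : ∀ t : ℕ, t < l.length → l[t]? = some (y (i + t))) :
    c (i + l.length) = c i + (l.flatMap σ).length := by
  induction l generalizing i with
  | nil => simp
  | cons a l ih =>
    have h0 := hl 0 (by simp)
    simp at h0
    have h1 := ih (i+1) (fun t ht => by
      have := hl (t+1) (by simpa using ht)
      simp only [List.getElem?_cons_succ] at this
      rw [this]; congr 2; push_cast; ring)
    rw [hc i, ← h0] at h1
    simp only [List.length_cons, List.flatMap_cons, List.length_append]
    push_cast
    rw [show i + ((l.length:ℤ) + 1) = i + 1 + l.length by ring, h1]
    ring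

lemma rep_list {σ : B → List C} {y : ℤ → B} {c : ℤ → ℤ} {z : ℤ → C}
    (h : Rep σ y c z) (l : List B) (i : ℤ)
    (hl : ∀ t : ℕ, t < l.length → l[t]? = some (y (i + t))) :
    ∀ m : ℕ, m < (l.flatMap σ).length → (l.flatMap σ)[m]? = some (z (c i + m)) := by
  induction l generalizing i with
  | nil => simp
  | cons a l ih =>
    have h0 := hl 0 (by simp)
    simp at h0
    have h1 := ih (i+1) (fun t ht => by
      have := hl (t+1) (by simpa using ht)
      simp only [List.getElem?_cons_succ] at this
      rw [this]; congr 2; push_cast; ring)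
    intro m hm
    simp only [List.flatMap_cons, List.length_append] at hm ⊢
    rcases lt_or_ge m (σ a).length with h2 | h2
    · rw [List.getElem?_append_left h2, h0]
      rw [h0] at h2
      exact h.2 i m h2
    · rw [List.getElem?_append_right h2, h1 _ (by omega), h.1 i, ← h0]
      congr 2
      omega

lemma decompose {D : Type*} {τ : B → List C} (hτ : ∀ a, τ a ≠ []) {w : C → List D}
    {y : ℤ → B} {c : ℤ → ℤ} {z : ℤ → D} (h : Rep (fun a => (τ a).flatMap w) y c z) :
    ∃ b u e, Rep τ y b u ∧ Rep w u e z ∧ ∀ j, e (b j) = c j := by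
  obtain ⟨b, u, hb0, hbu⟩ := concat_exists hτ y
  obtain ⟨e, he0, he⟩ := exists_cum (fun j => ((w (u j)).length : ℤ)) (c 0)
  have hstep : ∀ j, e (b (j+1)) = e (b j) + ((τ (y j)).flatMap w).length := by
    intro j
    rw [hbu.1 j]
    exact cum_list he (τ (y j)) (b j) (hbu.2 j)
  have heb : ∀ j, e (b j) = c j := by
    intro j
    induction j using Int.induction_on with
    | zero => rw [hb0, he0]
    | succ i ih => rw [hstep, h.1, ih]
    | pred i ih =>
      have h1 := hstep (-(i:ℤ)-1)
      have h2 := h.1 (-(i:ℤ)-1)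
      rw [sub_add_cancel] at h1 h2
      simp only at h2
      omega
  refine ⟨b, u, e, hbu, ⟨he, ?_⟩, heb⟩
  intro t m hm
  obtain ⟨j, hj1, hj2⟩ := find_block (Rep.strictMono hτ hbu.1) t
  obtain ⟨s, hs⟩ := Int.eq_ofNat_of_zero_le (show 0 ≤ t - b j by omega)
  obtain rfl : t = b j + s := by omega
  have hslt : s < (τ (y j)).length := by rw [hbu.1 j] at hj2; omega
  have hu := hbu.2 j s hslt
  set W := τ (y j) with hW
  have hW' : W = W.take s ++ u (b j + s) :: W.drop (s+1) := by
    have : W[s] = u (b j + s) := by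
      rw [List.getElem?_eq_getElem hslt] at hu
      exact Option.some.inj hu
    rw [← this, ← List.drop_eq_getElem_cons hslt, List.take_append_drop]
  have hlen : (W.take s).length = s := by simp; omega
  have het := cum_list he (W.take s) (b j) (fun t ht => by
    rw [hlen] at ht
    rw [List.getElem?_take_of_lt ht]
    exact hbu.2 j t (by rw [← hW]; omega))
  rw [hlen, heb] at het
  have hf : W.flatMap w = (W.take s).flatMap w ++ (w (u (b j + s)) ++ (W.drop (s+1)).flatMap w) := by
    conv_lhs => rw [hW']
    simp
  have key := h.2 j (((W.take s).flatMap w).length + m) (by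
    simp only [← hW, hf, List.length_append]; omega)
  simp only [← hW, hf] at key
  rw [List.getElem?_append_right (by omega), Nat.add_sub_cancel_left,
    List.getElem?_append_left hm] at key
  rw [key, het]
  congr 2
  push_cast; ring

lemma factorAt_eq (y : ℤ → B) (i : ℤ) (m : ℕ) :
    factorAt y i m = (List.range m).map (fun j : ℕ => y (i + j)) := by
  unfold factorAt
  induction m with
  | zero => simp
  | succ m ih =>
    simp [List.range_succ] at ih ⊢
    exact ih

lemma factorAt_shiftBy (y : ℤ → B) (s i : ℤ) (m : ℕ) :
    factorAt (shiftBy s y) i m = factorAt y (i + s) m := by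
  simp only [factorAt_eq, shiftBy]
  apply List.map_congr_left
  intro j _
  congr 1; ring

lemma length_factorAt (y : ℤ → B) (i : ℤ) (m : ℕ) : (factorAt y i m).length = m := by
  simp [factorAt_eq]

lemma getElem?_factorAt (y : ℤ → B) (i : ℤ) (m t : ℕ) (h : t < m) :
    (factorAt y i m)[t]? = some (y (i + t)) := by
  simp [factorAt_eq, h]

lemma factorAt_infix {W : List C} {u : ℤ → C} {a i : ℤ} {m : ℕ}
    (hW : ∀ t : ℕ, t < W.length → W[t]? = some (u (a + t)))
    (h1 : a ≤ i) (h2 : i + m ≤ a + W.length) : factorAt u i m <:+: W := by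
  obtain ⟨s, hs⟩ := Int.eq_ofNat_of_zero_le (show 0 ≤ i - a by omega)
  have : factorAt u i m = (W.drop s).take m := by
    apply List.ext_getElem?
    intro t
    rcases lt_or_ge t m with h | h
    · rw [getElem?_factorAt _ _ _ _ h, List.getElem?_take_of_lt h, List.getElem?_drop,
        hW _ (by omega)]
      congr 2
      push_cast; omega
    · rw [List.getElem?_eq_none (by rw [length_factorAt]; exact h),
        List.getElem?_eq_none (by simp; omega)]
  rw [this]
  exact (List.take_prefix _ _).isInfix.trans (List.drop_suffix _ _).isInfix

lemma infix_flatMap {l l' : List B} (σ : B → List C) (h : l <:+: l') :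
    l.flatMap σ <:+: l'.flatMap σ := by
  obtain ⟨s, t, rfl⟩ := h
  exact ⟨s.flatMap σ, t.flatMap σ, by simp⟩

section sadic

variable {A : ℕ → Type} {τ : ∀ n, A (n+1) → List (A n)}

lemma flatMap_heq {n m m' : ℕ} (h : m = m') (f : A m → List (A n)) (g : A m' → List (A n))
    (hfg : ∀ b b', HEq b b' → f b = g b') (a : A (m+1)) (a' : A (m'+1)) (ha : HEq a a') :
    (τ m a).flatMap f = (τ m' a').flatMap g := by
  subst h
  obtain rfl := eq_of_heq ha
  congr 1
  funext b
  exact hfg b b HEq.rfl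

lemma sadic_heq (n k : ℕ) (a : A (n+(k+1))) (a' : A (n+1+k)) (h : HEq a a') :
    sadicWordAux τ n (k+1) a = (sadicWordAux τ (n+1) k a').flatMap (τ n) := by
  induction k with
  | zero =>
    obtain rfl := eq_of_heq h
    simp [sadicWordAux]
  | succ k ih =>
    rw [sadicWordAux, sadicWordAux, List.flatMap_assoc]
    exact flatMap_heq (by omega) _ _ (fun b b' hb => ih b b' hb) a a' h

lemma word0_heq (k : ℕ) (a : A (0+k)) (a' : A k) (h : HEq a a') :
    sadicWordAux τ 0 k a = word0 τ k a' := by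
  induction k with
  | zero =>
    obtain rfl := eq_of_heq h
    simp [sadicWordAux, word0]
  | succ k ih =>
    rw [sadicWordAux, word0]
    exact flatMap_heq (by omega) _ _ (fun b b' hb => ih b b' hb) a a' h

lemma word0_add (n k : ℕ) (a : A (n+k)) :
    word0 τ (n+k) a = (sadicWordAux τ n k a).flatMap (word0 τ n) := by
  induction k with
  | zero => simp [sadicWordAux]
  | succ k ih =>
    rw [sadicWordAux, List.flatMap_assoc]
    change (τ (n+k) a).flatMap (word0 τ (n+k)) = _
    congr 1
    funext b
    exact ih b

lemma word0_ne (hNE : NonErasing τ) (n : ℕ) (a : A n) : word0 τ n a ≠ [] := by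
  induction n with
  | zero => simp [word0]
  | succ n ih =>
    rw [word0]
    obtain ⟨b, hb⟩ := List.exists_mem_of_ne_nil _ (hNE n a)
    intro h
    exact ih b (List.flatMap_eq_nil_iff.1 h b hb)

lemma sadic_ne (hNE : NonErasing τ) (n k : ℕ) (a : A (n+k)) : sadicWordAux τ n k a ≠ [] := by
  induction k with
  | zero => simp [sadicWordAux]
  | succ k ih =>
    rw [sadicWordAux]
    obtain ⟨b, hb⟩ := List.exists_mem_of_ne_nil _ (hNE _ a)
    intro h
    exact ih b (List.flatMap_eq_nil_iff.1 h b hb)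

lemma prim_mono (hNE : NonErasing τ) {n k : ℕ}
    (h : ∀ (a : A (n+k)) (b : A n), b ∈ sadicWordAux τ n k a) {k' : ℕ} (hk : k ≤ k') :
    ∀ (a : A (n+k')) (b : A n), b ∈ sadicWordAux τ n k' a := by
  induction k', hk using Nat.le_induction with
  | base => exact h
  | succ k' _ ih =>
    intro a b
    rw [sadicWordAux]
    obtain ⟨c, hc⟩ := List.exists_mem_of_ne_nil _ (hNE _ a)
    exact List.mem_flatMap.2 ⟨c, hc, ih c b⟩

lemma XLevel_shift {n : ℕ} {y : ℤ → A n} (hy : y ∈ XLevel τ n) (s : ℤ) :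
    shiftBy s y ∈ XLevel τ n := by
  intro i m
  rw [factorAt_shiftBy]
  exact hy _ _

lemma XLevel_down (hNE : NonErasing τ) {n : ℕ} {y : ℤ → A (n+1)} (hy : y ∈ XLevel τ (n+1))
    {b : ℤ → ℤ} {u : ℤ → A n} (h : Rep (τ n) y b u) : u ∈ XLevel τ n := by
  intro i m
  have hb := Rep.strictMono (hNE n) h.1
  obtain ⟨j, hj1, hj2⟩ := find_block hb i
  obtain ⟨k, hk, a, ha⟩ := hy j (m+1)
  have hl : ∀ t : ℕ, t < (factorAt y j (m+1)).length →
      (factorAt y j (m+1))[t]? = some (y (j + t)) := fun t ht =>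
    getElem?_factorAt _ _ _ _ (by rwa [length_factorAt] at ht)
  have h1 := rep_list h _ j hl
  have h2 := cum_list h.1 _ j hl
  rw [length_factorAt] at h2
  have h3 := strict_add hb (show j + 1 ≤ j + ((m+1:ℕ):ℤ) by push_cast; omega)
  have h4 : factorAt u i m <:+: (factorAt y j (m+1)).flatMap (τ n) :=
    factorAt_infix h1 hj1 (by push_cast at *; omega)
  have e : n + 1 + k = n + (k + 1) := by omega
  refine ⟨k+1, by omega, cast (congrArg A e) a, ?_⟩
  rw [sadic_heq n k _ a (cast_heq _ _)]
  exact h4.trans (infix_flatMap _ ha)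

lemma rep_unique_one {B C : Type} {σ : B → List C} (hσ : ∀ a, σ a ≠ []) {Y : Set (ℤ → B)}
    (hY : ∀ y ∈ Y, ∀ s, shiftBy s y ∈ Y) (hR : RecognizableIn σ Y) {z : ℤ → C}
    {y y' : ℤ → B} {c c' : ℤ → ℤ} (hy : y ∈ Y) (hy' : y' ∈ Y)
    (h : Rep σ y c z) (h' : Rep σ y' c' z) :
    ∃ r, ∀ j, y' j = y (j + r) ∧ c' j = c (j + r) := by
  have key : ∀ (y : ℤ → B) (c : ℤ → ℤ), y ∈ Y → Rep σ y c z →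
      ∃ (j : ℤ) (k : ℕ), IsCenteredRep σ Y z (shiftBy j y) k ∧ c j = -k := by
    intro y c hy h
    obtain ⟨j, hj1, hj2⟩ := find_block (Rep.strictMono hσ h.1) 0
    obtain ⟨k, hk⟩ := Int.eq_ofNat_of_zero_le (show 0 ≤ - c j by omega)
    refine ⟨j, k, ⟨hY y hy j, ?_, fun t => c (t + j) - c j, by simp, ?_, ?_⟩, by omega⟩
    · have := h.1 j
      simp only [shiftBy, zero_add]
      omega
    · intro t
      have := h.1 (t + j)
      simp only [shiftBy]
      rw [show t + 1 + j = t + j + 1 by ring, this]; ring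
    · intro t m
      have := h.2 (t+j) m m.2
      simp only [shiftBy]
      rw [show c (t+j) - c j + (m:ℕ) - (k:ℤ) = c (t+j) + (m:ℕ) by omega]
      have e := List.getElem?_eq_getElem m.2
      simp only [shiftBy] at e
      rw [this] at e
      exact Option.some.inj e
  obtain ⟨j, k, h1, h2⟩ := key y c hy h
  obtain ⟨j', k', h1', h2'⟩ := key y' c' hy' h'
  obtain ⟨e1, e2⟩ := hR z _ _ _ _ h1 h1'
  have ey : ∀ t, y' t = y (t + (j - j')) := by
    intro t
    have := congrFun e1 (t - j')
    simp only [shiftBy] at this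
    rw [show t + (j - j') = t - j' + j by ring, this]
    congr 1; ring
  have ec : ∀ t : ℤ, c' (j' + t) = c (j + t) := by
    intro t
    induction t using Int.induction_on with
    | zero => simp [h2, h2', e2]
    | succ i ih =>
      rw [← add_assoc, ← add_assoc, h.1, h'.1, ih, ey]
      congr 5; ring
    | pred i ih =>
      have a1 := h.1 (j + (-(i:ℤ) - 1))
      have a2 := h'.1 (j' + (-(i:ℤ) - 1))
      rw [ey, show j' + (-(i:ℤ) - 1) + (j - j') = j + (-(i:ℤ) - 1) by ring] at a2
      rw [show j + (-(i:ℤ) - 1) + 1 = j + -(i:ℤ) by ring] at a1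
      rw [show j' + (-(i:ℤ) - 1) + 1 = j' + -(i:ℤ) by ring] at a2
      omega
  refine ⟨j - j', fun t => ⟨ey t, ?_⟩⟩
  have := ec (t - j')
  rw [show j' + (t - j') = t by ring] at this
  rw [this]; congr 1; ring

lemma rep_unique (hNE : NonErasing τ) (hR : RecognizableSeq τ) (n : ℕ) {z : ℤ → A 0}
    {y y' : ℤ → A n} {c c' : ℤ → ℤ} (hy : y ∈ XLevel τ n) (hy' : y' ∈ XLevel τ n)
    (h : Rep (word0 τ n) y c z) (h' : Rep (word0 τ n) y' c' z) :
    ∃ r, ∀ j, y' j = y (j + r) ∧ c' j = c (j + r) := by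
  induction n generalizing c c' with
  | zero =>
    have key : ∀ (y : ℤ → A 0) (c : ℤ → ℤ), Rep (word0 τ 0) y c z →
        (∀ j, c j = c 0 + j) ∧ ∀ j, y j = z (c 0 + j) := by
      intro y c h
      have h1 : ∀ j, c j = c 0 + j := by
        intro j
        induction j using Int.induction_on with
        | zero => simp
        | succ i ih => rw [h.1, ih]; simp [word0]; ring
        | pred i ih =>
          have := h.1 (-(i:ℤ)-1)
          rw [sub_add_cancel, ih] at this
          simp [word0] at this
          omega
      refine ⟨h1, fun j => ?_⟩
      have := h.2 j 0 (by simp [word0])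
      simp [word0] at this
      rw [this, h1]
    obtain ⟨a1, a2⟩ := key y c h
    obtain ⟨b1, b2⟩ := key y' c' h'
    refine ⟨c' 0 - c 0, fun j => ⟨?_, ?_⟩⟩
    · rw [a2, b2]; congr 1; ring
    · rw [a1, b1]; ring
  | succ n ih =>
    obtain ⟨b, u, e, h1, h2, h3⟩ := decompose (hNE n) (w := word0 τ n) h
    obtain ⟨b', u', e', h1', h2', h3'⟩ := decompose (hNE n) (w := word0 τ n) h'
    obtain ⟨s, hs⟩ := ih (XLevel_down hNE hy h1) (XLevel_down hNE hy' h1') h2 h2'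
    have h4 : Rep (τ n) y' (fun j => b' j + s) u := by
      refine ⟨fun j => ?_, fun j m hm => ?_⟩
      · simp only [h1'.1 j]; ring
      · rw [h1'.2 j m hm, (hs _).1]
        congr 2; ring
    obtain ⟨r, hr⟩ := rep_unique_one (hNE n) (fun y hy s => XLevel_shift hy s) (hR n) hy hy' h1 h4
    refine ⟨r, fun j => ⟨(hr j).1, ?_⟩⟩
    rw [← h3', (hs _).2, (hr j).2, h3]

open Filter in
lemma ulim_exists {D : Type*} [Finite D] (U : Ultrafilter ℕ) (f : ℕ → D) :
    ∃ a, ∀ᶠ L in (U : Filter ℕ), f L = a := by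
  obtain ⟨a, ha⟩ := Ultrafilter.eq_pure_of_finite (U.map f)
  refine ⟨a, ?_⟩
  have : ({a} : Set D) ∈ U.map f := by rw [ha]; exact Set.mem_singleton a
  exact this

open Filter in
lemma ulim_rep {B C : Type} [Finite B] {σ : B → List C} (U : Ultrafilter ℕ)
    (y : ℕ → ℤ → B) (c : ℕ → ℤ → ℤ) (z : ℕ → ℤ → C) (Z : ℤ → C)
    (hrep : ∀ L, Rep σ (y L) (c L) (z L))
    (hZ : ∀ t, ∀ᶠ L in (U : Filter ℕ), z L t = Z t)
    (K : ℕ) (hK : ∀ L, -(K:ℤ) ≤ c L 0 ∧ c L 0 ≤ 0) :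
    ∃ Y c', Rep σ Y c' Z ∧ (∀ j, ∀ᶠ L in (U : Filter ℕ), y L j = Y j) ∧
      ∀ᶠ L in (U : Filter ℕ), c L 0 = c' 0 := by
  choose Y hY using fun j => ulim_exists U (fun L => y L j)
  obtain ⟨a, ha⟩ := ulim_exists U (fun L => (⟨c L 0, hK L⟩ : Set.Icc (-(K:ℤ)) 0))
  obtain ⟨c', h0, hc'⟩ := exists_cum (fun j => ((σ (Y j)).length : ℤ)) a.1
  have ha' : ∀ᶠ L in (U : Filter ℕ), c L 0 = c' 0 := by
    filter_upwards [ha] with L hL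
    rw [h0, ← hL]
  have hcc : ∀ j, ∀ᶠ L in (U : Filter ℕ), c L j = c' j := by
    intro j
    induction j using Int.induction_on with
    | zero => exact ha'
    | succ i ih =>
      filter_upwards [ih, hY i] with L h1 h2
      rw [(hrep L).1, hc', h1, h2]
    | pred i ih =>
      filter_upwards [ih, hY (-(i:ℤ)-1)] with L h1 h2
      have a1 := (hrep L).1 (-(i:ℤ)-1)
      have a2 := hc' (-(i:ℤ)-1)
      rw [sub_add_cancel] at a1 a2
      rw [h2] at a1
      omega
  refine ⟨Y, c', ⟨hc', fun j m hm => ?_⟩, hY, ha'⟩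
  obtain ⟨L, h1, h2, h3⟩ := ((hY j).and ((hcc j).and (hZ (c' j + m)))).exists
  have := (hrep L).2 j m (by rw [h1]; exact hm)
  rw [h1, h2, h3] at this
  exact this

lemma recenter {B C : Type} {σ : B → List C} (hσ : ∀ a, σ a ≠ []) {K : ℕ}
    (hK : ∀ a, (σ a).length ≤ K) {y : ℤ → B} {c : ℤ → ℤ} {z : ℤ → C} (h : Rep σ y c z) (n : ℤ) :
    ∃ j, Rep σ (shiftBy j y) (fun t => c (t + j) - n) (shiftBy n z) ∧
      -(K:ℤ) ≤ c j - n ∧ c j - n ≤ 0 := by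
  obtain ⟨j, h1, h2⟩ := find_block (Rep.strictMono hσ h.1) n
  refine ⟨j, ⟨fun t => ?_, fun t m hm => ?_⟩, ?_, by omega⟩
  · simp only [shiftBy]
    rw [show t + 1 + j = t + j + 1 by ring, h.1]; ring
  · simp only [shiftBy] at hm ⊢
    rw [h.2 _ m hm]
    congr 2; ring
  · have := h.1 j
    have := hK (y j)
    omega

lemma len_bound {B C : Type} [Fintype B] (σ : B → List C) : ∃ K : ℕ, ∀ a, (σ a).length ≤ K :=
  ⟨Finset.univ.sup fun a => (σ a).length,
    fun a => Finset.le_sup (f := fun a => (σ a).length) (Finset.mem_univ a)⟩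

open Filter in
lemma XLevel_lim {n : ℕ} (U : Ultrafilter ℕ) (y : ℕ → ℤ → A n) (Y : ℤ → A n)
    (hY : ∀ j, ∀ᶠ L in (U : Filter ℕ), y L j = Y j)
    (h : ∀ (i : ℤ) (m : ℕ), ∀ᶠ L in (U : Filter ℕ), ∃ k : ℕ, 0 < k ∧ ∃ a : A (n+k),
      (factorAt (y L) i m).IsInfix (sadicWordAux τ n k a)) : Y ∈ XLevel τ n := by
  intro i m
  have h1 : ∀ᶠ L in (U : Filter ℕ), ∀ j ∈ Finset.range m, y L (i + j) = Y (i + j) :=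
    (Filter.eventually_all_finset _).2 fun j _ => hY (i + j)
  obtain ⟨L, h2, h3⟩ := (h1.and (h i m)).exists
  have : factorAt (y L) i m = factorAt Y i m := by
    simp only [factorAt_eq]
    apply List.map_congr_left
    intro j hj
    exact h2 j (by simpa using hj)
  rwa [this] at h3

lemma factor_word0 (hNE : NonErasing τ) (hPrim : PrimitiveSeq τ)
    (hne : ∀ n, Nonempty (A n)) {x : ℤ → A 0} (hx : x ∈ XLevel τ 0)
    (N : ℕ) (i : ℤ) (m : ℕ) :
    ∃ k : ℕ, 0 < k ∧ ∃ b : A (N + k), factorAt x i m <:+: word0 τ (N+k) b := by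
  obtain ⟨k, _, a, ha⟩ := hx i m
  have e : 0 + k = k := by omega
  rw [word0_heq k a (cast (congrArg A e) a) (cast_heq _ _).symm] at ha
  generalize cast (congrArg A e) a = a' at ha
  obtain ⟨q, _, hq⟩ := hPrim k
  have hq' := prim_mono hNE hq (show q ≤ q + (N+1) by omega)
  have h1 : ∃ r, ∃ b : A r, N + 1 ≤ r ∧ factorAt x i m <:+: word0 τ r b := by
    obtain ⟨b⟩ := hne (k + (q + (N+1)))
    refine ⟨_, b, by omega, ?_⟩
    rw [word0_add]
    refine ha.trans ?_
    obtain ⟨s, t, hst⟩ := List.append_of_mem (hq' b a')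
    rw [hst]
    exact ⟨s.flatMap (word0 τ k), t.flatMap (word0 τ k), by simp⟩
  obtain ⟨r, b, hr, h2⟩ := h1
  obtain ⟨k', rfl⟩ := Nat.exists_eq_add_of_le (show N ≤ r by omega)
  exact ⟨k', by omega, b, h2⟩

open Filter in
lemma rep_exists [∀ n, Fintype (A n)] (hNE : NonErasing τ) (hPrim : PrimitiveSeq τ)
    (hne : ∀ n, Nonempty (A n)) {x : ℤ → A 0} (hx : x ∈ XLevel τ 0) (N : ℕ) :
    ∃ y c, y ∈ XLevel τ N ∧ Rep (word0 τ N) y c x := by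
  have hσ := word0_ne hNE N
  obtain ⟨K, hK⟩ := len_bound (word0 τ N)
  have main : ∀ L : ℕ, ∃ (y : ℤ → A N) (c : ℤ → ℤ) (z : ℤ → A 0), Rep (word0 τ N) y c z ∧
      (∀ t : ℤ, -(L:ℤ) ≤ t → t ≤ L → z t = x t) ∧ (-(K:ℤ) ≤ c 0 ∧ c 0 ≤ 0) ∧
      ∀ (i : ℤ) (m : ℕ), K * (i.natAbs + m + 1) ≤ L → ∃ k : ℕ, 0 < k ∧ ∃ a : A (N+k),
      (factorAt y i m).IsInfix (sadicWordAux τ N k a) := by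
    intro L
    obtain ⟨k, hk, b, hb⟩ := factor_word0 hNE hPrim hne hx N (-L) (2*L+1)
    rw [word0_add] at hb
    set l := sadicWordAux τ N k b with hl
    obtain ⟨dflt⟩ := hne N
    set y0 : ℤ → A N := fun j => (l[j.toNat]?).getD dflt with hy0
    have hly : ∀ t : ℕ, t < l.length → l[t]? = some (y0 (0 + t)) := by
      intro t ht
      simp [hy0, ht]
    obtain ⟨c, z, hc0, hrep⟩ := concat_exists hσ y0
    have h1 := rep_list hrep l 0 hly
    have h2 := cum_list hrep.1 l 0 hly
    have hmono := Rep.strictMono hσ hrep.1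
    obtain ⟨s, t, hst⟩ := hb
    have hlen : (l.flatMap (word0 τ N)).length = s.length + (2*L+1) + t.length := by
      rw [← hst]; simp [length_factorAt]; omega
    have hzx : ∀ u : ℕ, u < 2*L+1 → z (s.length + u) = x (-L + u) := by
      intro u hu
      have a1 := h1 (s.length + u) (by omega)
      rw [← hst, List.append_assoc, List.getElem?_append_right (by omega),
        Nat.add_sub_cancel_left, List.getElem?_append_left (by rw [length_factorAt]; exact hu),
        getElem?_factorAt _ _ _ _ hu, hc0] at a1
      rw [Option.some.inj a1]
      push_cast; simp
    obtain ⟨j, hj, hj1, hj2⟩ := recenter hσ hK hrep (s.length + L)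
    refine ⟨_, _, _, hj, ?_, by simp only [zero_add]; exact ⟨hj1, hj2⟩, ?_⟩
    · intro t ht1 ht2
      obtain ⟨u, hu⟩ := Int.eq_ofNat_of_zero_le (show 0 ≤ t + L by omega)
      have := hzx u (by omega)
      simp only [shiftBy]
      rw [show t + ((s.length:ℤ) + L) = s.length + u by omega, this]
      congr 1; omega
    · intro i m him
      refine ⟨k, hk, b, ?_⟩
      rw [factorAt_shiftBy]
      have hup : ∀ a : ℤ, ∀ r : ℕ, c (a + r) ≤ c a + K * r := by
        intro a r
        induction r with
        | zero => simp
        | succ r ih =>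
          have a1 := hrep.1 (a + r)
          have a2 := hK (y0 (a+r))
          push_cast
          rw [← add_assoc, mul_add]
          omega
      have hnn : (K * (i.natAbs + m + 1) : ℤ) ≤ L := by exact_mod_cast him
      have lo : 0 ≤ i + j := by
        rw [← hmono.le_iff_le, hc0]
        have a1 := hup (j - i.natAbs) i.natAbs
        rw [sub_add_cancel] at a1
        have a2 := hmono.monotone (show j - i.natAbs ≤ i + j by omega)
        have a3 : (0:ℤ) ≤ K * m := by positivity
        have a4 : (K * (i.natAbs + m + 1) : ℤ) = K * i.natAbs + K * m + K := by ring
        omega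
      have hi : i + j + m ≤ l.length := by
        rw [← hmono.le_iff_le]
        rw [zero_add, hlen, hc0] at h2
        rw [h2]
        have a1 := hup j (i.natAbs + m)
        have a2 := hmono.monotone (show i + j + m ≤ j + (i.natAbs + m : ℕ) by omega)
        have a4 : (K * (i.natAbs + m + 1) : ℤ) = K * (i.natAbs + m : ℕ) + K := by push_cast; ring
        push_cast at *
        omega
      exact factorAt_infix (a := 0) hly lo (by rw [← hl]; omega)
  choose y c z h1 h2 h3 h4 using main
  obtain ⟨Y, c', hr, hY, _⟩ := ulim_rep (hyperfilter ℕ) y c z x h1 (fun t => by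
    have : ∀ᶠ L in atTop, z L t = x t := by
      filter_upwards [eventually_ge_atTop t.natAbs] with L hL
      exact h2 L t (by omega) (by omega)
    rw [← Nat.cofinite_eq_atTop] at this
    exact Filter.hyperfilter_le_cofinite this) K h3
  refine ⟨Y, c', XLevel_lim _ y Y hY (fun i m => ?_), hr⟩
  have : ∀ᶠ L in atTop, ∃ k : ℕ, 0 < k ∧ ∃ a : A (N+k),
      (factorAt (y L) i m).IsInfix (sadicWordAux τ N k a) := by
    filter_upwards [eventually_ge_atTop (K * (i.natAbs + m + 1))] with L hL
    exact h4 L i m hL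
  rw [← Nat.cofinite_eq_atTop] at this
  exact Filter.hyperfilter_le_cofinite this

lemma cuts_dvd {n : ℕ} {y : ℤ → A n} {c : ℤ → ℤ} {z : ℤ → A 0} (h : Rep (word0 τ n) y c z)
    {d : ℕ} (hd : ∀ a, d ∣ (word0 τ n a).length) (j : ℤ) : (d:ℤ) ∣ c j - c 0 := by
  have hs : ∀ j, (d:ℤ) ∣ c (j+1) - c j := by
    intro j
    rw [h.1 j, add_sub_cancel_left]
    exact_mod_cast hd _
  induction j using Int.induction_on with
  | zero => simp
  | succ i ih => simpa using dvd_add (hs i) ih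
  | pred i ih =>
    have := hs (-(i:ℤ)-1)
    rw [sub_add_cancel] at this
    have := dvd_sub ih this
    ring_nf at this ⊢
    exact this

open Filter in
lemma part_two_window [∀ n, Fintype (A n)] (hNE : NonErasing τ) (hPrim : PrimitiveSeq τ)
    (hR : RecognizableSeq τ)
    (hne : ∀ n, Nonempty (A n)) {x : ℤ → A 0} (hx : x ∈ XLevel τ 0) (N : ℕ)
    {d : ℕ} (hd : ∀ a, d ∣ (word0 τ N a).length) :
    ∃ L : ℕ, ∀ n m : ℤ, (∀ j : ℤ, -(L:ℤ) ≤ j → j ≤ L → x (n + j) = x (m + j)) →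
      (d:ℤ) ∣ n - m := by
  by_contra hcon
  push Not at hcon
  choose p q hpq hnd using hcon
  obtain ⟨y, c, hy, hrep⟩ := rep_exists hNE hPrim hne hx N
  have hσ := word0_ne hNE N
  obtain ⟨K, hK⟩ := len_bound (word0 τ N)
  choose j h1 h2 using fun n => recenter hσ hK hrep n
  choose Z hZ using fun t => ulim_exists (hyperfilter ℕ) (fun L => shiftBy (p L) x t)
  obtain ⟨Y, e, hr, hY, he⟩ := ulim_rep (hyperfilter ℕ) _ _ _ Z (fun L => h1 (p L)) hZ K
    (fun L => by simpa using h2 (p L))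
  obtain ⟨Y', e', hr', hY', he'⟩ := ulim_rep (hyperfilter ℕ) _ _ _ Z (fun L => h1 (q L))
    (fun t => by
      have : ∀ᶠ L in atTop, shiftBy (p L) x t = shiftBy (q L) x t := by
        filter_upwards [eventually_ge_atTop t.natAbs] with L hL
        have := hpq L t (by omega) (by omega)
        simp only [shiftBy]
        rwa [add_comm t, add_comm t]
      rw [← Nat.cofinite_eq_atTop] at this
      filter_upwards [Filter.hyperfilter_le_cofinite this, hZ t] with L a1 a2
      rw [← a1, a2]) K
    (fun L => by simpa using h2 (q L))
  have m1 : Y ∈ XLevel τ N := XLevel_lim _ _ Y hY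
    (fun i m => Filter.Eventually.of_forall fun L => XLevel_shift hy _ i m)
  have m2 : Y' ∈ XLevel τ N := XLevel_lim _ _ Y' hY'
    (fun i m => Filter.Eventually.of_forall fun L => XLevel_shift hy _ i m)
  obtain ⟨r, hr2⟩ := rep_unique hNE hR N m1 m2 hr hr'
  have e0 := (hr2 0).2
  have d1 := cuts_dvd hr hd (0 + r)
  rw [← e0] at d1
  obtain ⟨L, a1, a2⟩ := (he.and he').exists
  apply hnd L
  rw [← a1, ← a2] at d1
  have b1 := cuts_dvd hrep hd (0 + j (p L))
  have b2 := cuts_dvd hrep hd (0 + j (q L))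
  have := dvd_add d1 (dvd_sub b1 b2)
  rwa [show c (0 + j (q L)) - q L - (c (0 + j (p L)) - p L) +
    (c (0 + j (p L)) - c 0 - (c (0 + j (q L)) - c 0)) = p L - q L by ring] at this

end sadic

lemma skel_shift_aux {x : ℤ → B} (hx : IsToeplitz x) {p : ℕ} (hp : 0 < p) {r s : ℤ}
    (h : ∀ L : ℕ, ∃ n m : ℤ, (p:ℤ) ∣ n - r ∧ (p:ℤ) ∣ m - s ∧
      ∀ j : ℕ, j < L → x (n + j) = x (m + j)) (hr : r ∈ PerSet x p) :
    s ∈ PerSet x p ∧ x s = x r := by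
  have key : ∀ k : ℤ, x (s + k * p) = x r := by
    intro k
    obtain ⟨q, hq, hq'⟩ := hx (s + k * p)
    obtain ⟨n, m, ⟨n', hn⟩, ⟨m', hm⟩, hnm⟩ := h (p * q)
    have hpq : (0:ℤ) < p * q := by positivity
    have i1 := Int.emod_nonneg (s + k * p - m) hpq.ne'
    have i2 := Int.emod_lt_of_pos (s + k * p - m) hpq
    have i3 := Int.emod_add_mul_ediv (s + k * p - m) (p * q)
    set v := (s + k * p - m) / ((p:ℤ) * q) with hv
    obtain ⟨i, hi⟩ := Int.eq_ofNat_of_zero_le i1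
    rw [hi] at i2 i3
    have e := hnm i (by exact_mod_cast i2)
    have e1 : m + i = s + k * p + (-(p * v)) * q := by linarith
    have e2 : n + i = r + (n' + k - m' - q * v) * p := by
      have : n = r + p * n' := by linarith
      have h2 : m = s + p * m' := by linarith
      rw [h2] at e1
      rw [this]
      linarith
    rw [e1, e2, hq', hr] at e
    exact e.symm
  have h0 := key 0
  simp only [zero_mul, add_zero] at h0
  exact ⟨fun k => by rw [key, h0], h0⟩

open Filter in
lemma part_one_window {x : ℤ → B} (hx : IsToeplitz x) {p : ℕ} (hp : IsEssentialPeriod x p) :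
    ∃ L : ℕ, ∀ n m : ℤ, (∀ j : ℕ, j < L → x (n + j) = x (m + j)) → (p:ℤ) ∣ n - m := by
  have hp0 : 0 < p := by have := hp.1; omega
  have key : ∀ q ∈ Finset.range p, ∀ s ∈ Finset.range p, ∀ᶠ L : ℕ in atTop, q ≠ 0 →
      ∀ n m : ℤ, (p:ℤ) ∣ n - (s + q) → (p:ℤ) ∣ m - s →
        ¬ ∀ j : ℕ, j < L → x (n + j) = x (m + j) := by
    intro q hq s hs
    rcases eq_or_ne q 0 with h0 | h0
    · simp [h0]
    by_contra hcon
    obtain ⟨i, hi⟩ := hp.2 q (by omega) (by simpa using hq)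
    have hall : ∀ L : ℕ, ∃ n m : ℤ, (p:ℤ) ∣ n - (s + q) ∧ (p:ℤ) ∣ m - s ∧
        ∀ j : ℕ, j < L → x (n + j) = x (m + j) := by
      intro L
      by_contra hL
      apply hcon
      filter_upwards [eventually_ge_atTop L] with L' hL' _ n m h1 h2 h3
      exact hL ⟨n, m, h1, h2, fun j hj => h3 j (by omega)⟩
    have hall' : ∀ t : ℤ, ∀ L : ℕ, ∃ n m : ℤ, (p:ℤ) ∣ n - (t + q) ∧ (p:ℤ) ∣ m - t ∧
        ∀ j : ℕ, j < L → x (n + j) = x (m + j) := by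
      intro t L
      obtain ⟨e, he⟩ : ∃ e : ℕ, (p:ℤ) ∣ (t - s) - e :=
        ⟨((t - s) % p).toNat, by
          rw [Int.toNat_of_nonneg (Int.emod_nonneg _ (by omega))]
          exact Int.dvd_self_sub_emod⟩
      obtain ⟨n, m, h1, h2, h3⟩ := hall (L + e)
      refine ⟨n + e, m + e, ?_, ?_, fun j hj => ?_⟩
      · have := dvd_sub h1 he
        rwa [show n - (s + q) - (t - s - e) = n + e - (t + q) by ring] at this
      · have := dvd_sub h2 he
        rwa [show m - s - (t - s - e) = m + e - t by ring] at this
      · have := h3 (e + j) (by omega)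
        push_cast at this
        rwa [← add_assoc, ← add_assoc] at this
    apply hi
    have f1 := skel_shift_aux hx hp0 (hall' i)
    have f2 := skel_shift_aux (r := i) (s := i + q) hx hp0 (fun L => by
      obtain ⟨n, m, h1, h2, h3⟩ := hall' i L
      exact ⟨m, n, h2, h1, fun j hj => (h3 j hj).symm⟩)
    unfold Skel
    by_cases hc : i ∈ PerSet x p
    · have := f2 hc
      rw [if_pos hc, if_pos this.1, this.2]
    · have : ¬ (i + q ∈ PerSet x p) := fun h => hc (f1 h).1
      rw [if_neg hc, if_neg this]
  have key2 : ∀ᶠ L : ℕ in atTop, ∀ q ∈ Finset.range p, ∀ s ∈ Finset.range p, q ≠ 0 →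
      ∀ n m : ℤ, (p:ℤ) ∣ n - (s + q) → (p:ℤ) ∣ m - s →
        ¬ ∀ j : ℕ, j < L → x (n + j) = x (m + j) :=
    (Filter.eventually_all_finset _).2 fun q hq =>
      (Filter.eventually_all_finset _).2 fun s hs => key q hq s hs
  obtain ⟨L, hL⟩ := key2.exists
  refine ⟨L, fun n m hnm => ?_⟩
  by_contra hnd
  have hpz : (p:ℤ) ≠ 0 := by omega
  have hpp : (0:ℤ) < p := by omega
  have q0 := Int.emod_nonneg (n - m) hpz
  have q1 := Int.emod_lt_of_pos (n - m) hpp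
  have s0 := Int.emod_nonneg m hpz
  have s1 := Int.emod_lt_of_pos m hpp
  have dq : (p:ℤ) ∣ (n - m) - (n - m) % p := Int.dvd_self_sub_emod
  have ds : (p:ℤ) ∣ m - m % p := Int.dvd_self_sub_emod
  refine hL ((n-m) % p).toNat (by simp; omega) (m % p).toNat (by simp; omega) ?_ n m ?_ ?_ hnm
  · intro h
    apply hnd
    exact Int.dvd_of_emod_eq_zero (by omega)
  · rw [Int.toNat_of_nonneg q0, Int.toNat_of_nonneg s0]
    have := dvd_add dq ds
    rwa [show n - m - (n - m) % p + (m - m % p) = n - (m % p + (n - m) % p) by ring] at this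
  · rwa [Int.toNat_of_nonneg s0]

lemma toeplitz_window {x : ℤ → B} (hx : IsToeplitz x) (L : ℕ) :
    ∃ p : ℕ, 0 < p ∧ ∀ j : ℤ, -(L:ℤ) ≤ j → j ≤ L → j ∈ PerSet x p := by
  choose P hP1 hP2 using hx
  refine ⟨∏ j ∈ Finset.Icc (-(L:ℤ)) L, P j,
    Finset.prod_pos fun j _ => by have := hP1 j; omega, fun j h1 h2 k => ?_⟩
  obtain ⟨e, he⟩ := Finset.dvd_prod_of_mem P (Finset.mem_Icc.2 ⟨h1, h2⟩)
  rw [he, ← hP2 j (k * e)]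
  congr 1; push_cast; ring

lemma essential_window {x : ℤ → B} (hx : IsToeplitz x) (hap : IsAperiodicPoint x) (L : ℕ) :
    ∃ p : ℕ, IsEssentialPeriod x p ∧ ∀ j : ℤ, -(L:ℤ) ≤ j → j ≤ L → j ∈ PerSet x p := by
  classical
  have hex := toeplitz_window hx L
  obtain ⟨h0, h1⟩ := Nat.find_spec hex
  set p := Nat.find hex with hp
  refine ⟨p, ⟨?_, ?_⟩, h1⟩
  · by_contra hlt
    have e1 : p = 1 := by omega
    have h2 := h1 0 (by omega) (by omega)
    rw [e1] at h2
    apply hap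
    refine ⟨1, one_pos, fun i => ?_⟩
    have a1 := h2 i
    have a2 := h2 (i+1)
    simp only [Nat.cast_one, mul_one, zero_add] at a1 a2 ⊢
    rw [a1, a2]
  · intro q hq0 hq
    by_contra hcon
    push Not at hcon
    refine Nat.find_min hex hq ⟨hq0, fun j hj1 hj2 k => ?_⟩
    have hk : Skel x p (j + k * q) = Skel x p j := by
      induction k using Int.induction_on with
      | zero => simp
      | succ i ih => rw [← ih, ← hcon (j + i * q)]; congr 1; ring
      | pred i ih => rw [← ih, ← hcon (j + (-(i:ℤ) - 1) * q)]; congr 1; ring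
    have hj := h1 j hj1 hj2
    unfold Skel at hk
    rw [if_pos hj] at hk
    split_ifs at hk with h
    exact Option.some.inj hk

lemma part_one {A : ℕ → Type} [∀ n, Fintype (A n)] {τ : ∀ n, A (n+1) → List (A n)}
    (hNE : NonErasing τ) (hPrim : PrimitiveSeq τ) (hProp : ProperSeq τ)
    (hne : ∀ n, Nonempty (A n)) {x : ℤ → A 0} (hx : x ∈ XLevel τ 0) (hT : IsToeplitz x)
    {p : ℕ} (hp : IsEssentialPeriod x p) :
    ∃ i, ∀ a : A (i+1), p ∣ (word0 τ (i+1) a).length := by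
  obtain ⟨L, hL⟩ := part_one_window hT hp
  have hgrow : ∃ i, ∀ b : A i, L ≤ (word0 τ i b).length := by
    obtain ⟨k, _, a, ha⟩ := factor_word0 hNE hPrim hne hx 0 0 L
    obtain ⟨q, _, hq⟩ := hPrim (0 + k)
    refine ⟨0 + k + q, fun b => ?_⟩
    rw [word0_add]
    obtain ⟨s, t, hst⟩ := List.append_of_mem (hq b a)
    have := ha.length_le
    rw [length_factorAt] at this
    rw [hst]
    simp only [List.flatMap_append, List.flatMap_cons, List.length_append]
    omega
  obtain ⟨i, hi⟩ := hgrow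
  refine ⟨i, fun a => ?_⟩
  obtain ⟨b, _, hb⟩ := hProp i
  have hpre : ∀ a : A (i+1), ∃ v, word0 τ (i+1) a = word0 τ i b ++ v := by
    intro a
    obtain ⟨l, hl⟩ := List.head?_eq_some_iff.1 (hb a).1
    exact ⟨l.flatMap (word0 τ i), by rw [word0, hl]; simp⟩
  obtain ⟨k, _, hk⟩ := hPrim (i+1)
  obtain ⟨y, c, _, hrep⟩ := rep_exists hNE hPrim hne hx (i+1+k)
  have hfun : word0 τ (i+1+k) = fun a => (sadicWordAux τ (i+1) k a).flatMap (word0 τ (i+1)) :=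
    funext fun a => word0_add _ _ a
  rw [hfun] at hrep
  obtain ⟨b', u, e, h1, h2, _⟩ := decompose (fun a => sadic_ne hNE (i+1) k a) hrep
  obtain ⟨m, hm, hma⟩ := List.getElem_of_mem (hk (y 0) a)
  have hu : u (b' 0 + m) = a := by
    have := h1.2 0 m hm
    rw [List.getElem?_eq_getElem hm, hma] at this
    exact (Option.some.inj this).symm
  have hval : ∀ t : ℤ, ∀ j : ℕ, j < L → (word0 τ i b)[j]? = some (x (e t + j)) := by
    intro t j hj
    obtain ⟨v, hv⟩ := hpre (u t)
    have hlt : j < (word0 τ i b).length := lt_of_lt_of_le hj (hi b)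
    have := h2.2 t j (by rw [hv, List.length_append]; omega)
    rwa [hv, List.getElem?_append_left hlt] at this
  have hd := hL (e (b' 0 + m + 1)) (e (b' 0 + m)) (fun j hj =>
    Option.some.inj ((hval _ j hj).symm.trans (hval _ j hj)))
  rw [h2.1, add_sub_cancel_left, hu] at hd
  exact_mod_cast hd

/-- For a primitive, proper and recognizable directive sequence of finite
alphabet rank whose S-adic subshift is an aperiodic Toeplitz subshift, with
`d i = gcd{|τ_{[0,i+1)}(a)| : a ∈ A (i+1)}`: every essential period of `X_τ` divides some
`d i`, and every `d i` divides some essential period of `X_τ`. -/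
theorem statement1 (A : ℕ → Type) [∀ n, Fintype (A n)]
    [TopologicalSpace (A 0)] [DiscreteTopology (A 0)]
    (τ : ∀ n, A (n+1) → List (A n))
    (hNE : NonErasing τ) (hPrim : PrimitiveSeq τ) (hProp : ProperSeq τ)
    (hRec : RecognizableSeq τ)
    (hFR : ∃ K : ℕ, AlphabetRankLE A K)
    (hT : IsToeplitzSubshift (XLevel τ 0))
    (hap : ∀ x ∈ XLevel τ 0, IsAperiodicPoint x)
    (d : ℕ → ℕ)
    (hd : ∀ i, d i = (Finset.univ : Finset (A (i+1))).gcd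
      (fun a => (word0 τ (i+1) a).length)) :
    ∀ x : ℤ → A 0, ToeplitzGenerates x (XLevel τ 0) →
      (∀ p : ℕ, IsEssentialPeriod x p → ∃ i, p ∣ d i) ∧
      (∀ i, ∃ p : ℕ, IsEssentialPeriod x p ∧ d i ∣ p) := by
  intro x hx
  have hne : ∀ n, Nonempty (A n) := fun n => ⟨(hProp n).choose⟩
  have hxX : x ∈ XLevel τ 0 := by
    rw [hx.2]
    exact subset_closure ⟨0, by funext i; simp [shiftBy]⟩
  refine ⟨fun p hp => ?_, fun i => ?_⟩
  · obtain ⟨i, hi⟩ := part_one hNE hPrim hProp hne hxX hx.1 hp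
    exact ⟨i, by rw [hd]; exact Finset.dvd_gcd fun a _ => hi a⟩
  · obtain ⟨L, hL⟩ := part_two_window hNE hPrim hRec hne hxX (i+1) (d := d i) (fun a => by
      rw [hd]; exact Finset.gcd_dvd (Finset.mem_univ a))
    obtain ⟨p, hp, hper⟩ := essential_window hx.1 (hap x hxX) L
    refine ⟨p, hp, ?_⟩
    have := hL p 0 (fun j h1 h2 => by
      have := hper j h1 h2 1
      rw [zero_add, ← this]; congr 1; ring)
    rw [sub_zero] at this
    exact_mod_cast this

end ToeplitzFR
end
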